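/- arXiv:1810.03125 — 4 statements merged into one kernel-verified Lean document; each statement's English description precedes it below -/
import Mathlib

section
/- Let N > 3 and let ρ be a completely symmetric state on ℝ^N ⊗ ℝ^N, supported on ℝ^N ⊗ ℝ^N, with rank(ρ) = N + 1. If ρ is irreducible, then ρ is S-separable. If ρ is reducible, then ρ = σ + (x xᵀ) ⊗ (x xᵀ) for some vector x ∈ ℝ^N, where σ is a completely symmetric positive semidefinite matrix with rank(σ) = N whose reduced matrix σ₁ has rank N − 1 (i.e. σ is supported in an (N−1)⊗(N−1) subspace). -/
open Matrix
open Kronecker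
open scoped BigOperators

/-- A matrix on `ℝ^N ⊗ ℝ^N`, with entries `ρ_{ijkl} = ρ (i,k) (j,l)`, is completely
symmetric if its entries are invariant under every permutation of the four indices. -/
def CompletelySymmetric {N : ℕ} (ρ : Matrix (Fin N × Fin N) (Fin N × Fin N) ℝ) : Prop :=
  ∀ (π : Equiv.Perm (Fin 4)) (v : Fin 4 → Fin N),
    ρ (v (π 0), v (π 2)) (v (π 1), v (π 3)) = ρ (v 0, v 2) (v 1, v 3)

/-- `ρ` is S-separable if it is a finite sum of terms `(x xᵀ) ⊗ (x xᵀ)`. -/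
def SSeparable {N : ℕ} (ρ : Matrix (Fin N × Fin N) (Fin N × Fin N) ℝ) : Prop :=
  ∃ (L : ℕ) (x : Fin L → Fin N → ℝ),
    ρ = ∑ t, vecMulVec (x t) (x t) ⊗ₖ vecMulVec (x t) (x t)

/-- `ρ` is separable over ℝ if it is a finite sum of terms `(x xᵀ) ⊗ (y yᵀ)`. -/
def SeparableR {N : ℕ} (ρ : Matrix (Fin N × Fin N) (Fin N × Fin N) ℝ) : Prop :=
  ∃ (L : ℕ) (x y : Fin L → Fin N → ℝ),
    ρ = ∑ t, vecMulVec (x t) (x t) ⊗ₖ vecMulVec (y t) (y t)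

/-- The reduced matrix `ρ₁`, with `(ρ₁)_{ij} = Σ_k ρ_{ijkk}`. -/
def reducedMat {N : ℕ} (ρ : Matrix (Fin N × Fin N) (Fin N × Fin N) ℝ) :
    Matrix (Fin N) (Fin N) ℝ :=
  Matrix.of fun i j => ∑ k, ρ (i, k) (j, k)

/-- `ρ` is G-invariant if it equals its partial transpose
`ρ^{T₁}((i,k),(j,l)) = ρ((j,k),(i,l))`. -/
def GInvariant {N : ℕ} (ρ : Matrix (Fin N × Fin N) (Fin N × Fin N) ℝ) : Prop :=
  ∀ i j k l, ρ (i, k) (j, l) = ρ (j, k) (i, l)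

/-- The column space of a matrix, as a submodule. -/
def colSpace {n : Type*} [Fintype n] [DecidableEq n] (M : Matrix n n ℝ) :
    Submodule ℝ (n → ℝ) :=
  LinearMap.range (Matrix.toLin' M)

/-- `ρ` is reducible if it splits as `σ + δ` with `σ, δ` nonzero positive semidefinite and
the column space of `ρ₁` the direct sum of the column spaces of `σ₁` and `δ₁`. -/
def Reducible {N : ℕ} (ρ : Matrix (Fin N × Fin N) (Fin N × Fin N) ℝ) : Prop :=
  ∃ σ δ : Matrix (Fin N × Fin N) (Fin N × Fin N) ℝ,
    σ.PosSemidef ∧ δ.PosSemidef ∧ σ ≠ 0 ∧ δ ≠ 0 ∧ ρ = σ + δ ∧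
    colSpace (reducedMat ρ) = colSpace (reducedMat σ) ⊔ colSpace (reducedMat δ) ∧
    colSpace (reducedMat σ) ⊓ colSpace (reducedMat δ) = ⊥

theorem jacobi_coordinates {ι : Type*} [Fintype ι] [DecidableEq ι]
    (b : ι → ι → ι → ℝ) (γ : ι → ℝ)
    (h₁ : ∀ i j k, b i j k = b j i k) (h₂ : ∀ i j k, b i j k = b i k j)
    (hb : ∀ m n x y,
      (∑ a, b m x a * b n y a) + (if m = x then γ m else 0) * (if n = y then γ n else 0) =
        (∑ a, b m y a * b n x a) + (if m = y then γ m else 0) * (if n = x then γ n else 0))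
    (m n p x y : ι) :
    γ p * (γ m - γ n) * (b m n y * (if p = x then 1 else 0) + b m n x * (if p = y then 1 else 0)) +
    γ m * (γ n - γ p) * (b n p y * (if m = x then 1 else 0) + b n p x * (if m = y then 1 else 0)) +
    γ n * (γ p - γ m) * (b p m y * (if n = x then 1 else 0) + b p m x * (if n = y then 1 else 0)) = 0 := by
  set B : ι → Matrix ι ι ℝ := fun i => Matrix.of (b i) with hB
  have key : ∀ m n, B m * B n - B n * B m =
      (γ m * γ n) • (single n m (1 : ℝ) - single m n 1) := by
    intro m n
    ext x y
    have h := hb m n x y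
    have e₁ : (B m * B n) x y = ∑ a, b m x a * b n y a := by
      simp only [mul_apply, hB, of_apply]
      exact Finset.sum_congr rfl fun a _ => by rw [h₂ n y a]
    have e₂ : (B n * B m) x y = ∑ a, b m y a * b n x a := by
      simp only [mul_apply, hB, of_apply]
      exact Finset.sum_congr rfl fun a _ => by rw [h₂ m y a, mul_comm]
    rw [Matrix.sub_apply, e₁, e₂, Matrix.smul_apply, Matrix.sub_apply, single_apply, single_apply, smul_eq_mul]
    have c₁ : ∀ u v, (if u = v then γ u else 0) = γ u * (if u = v then 1 else 0) := by simp
    have c₂ : ∀ u v z w : ι, (if u = v ∧ z = w then (1 : ℝ) else 0) =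
        (if u = v then 1 else 0) * (if z = w then 1 else 0) := by
      intro u v z w
      rw [ite_and]
      split_ifs <;> simp
    rw [c₁, c₁, c₁, c₁] at h
    rw [c₂, c₂]
    linear_combination h
  have jac : (B p * (B m * B n - B n * B m) - (B m * B n - B n * B m) * B p) +
      (B m * (B n * B p - B p * B n) - (B n * B p - B p * B n) * B m) +
      (B n * (B p * B m - B m * B p) - (B p * B m - B m * B p) * B n) = 0 := by
    noncomm_ring
  rw [key, key, key] at jac
  have hl : ∀ (i j k x y : ι), (B i * single j k (1 : ℝ)) x y = b i j x * (if k = y then 1 else 0) := by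
    intro i j k x y
    rw [mul_apply]
    simp [single_apply, hB, h₂ i x j, ite_and]
  have hr : ∀ (i j k x y : ι), (single j k (1 : ℝ) * B i) x y = b i k y * (if j = x then 1 else 0) := by
    intro i j k x y
    rw [mul_apply]
    simp [single_apply, hB, ite_and]
  have h := congrFun (congrFun jac x) y
  simp only [mul_sub, sub_mul, Matrix.mul_smul, Matrix.smul_mul, smul_sub, Matrix.add_apply,
    Matrix.sub_apply, Matrix.smul_apply, hl, hr, smul_eq_mul, Matrix.zero_apply] at h
  rw [h₁ p n x, h₁ p n y, h₁ m p x, h₁ m p y, h₁ n m x, h₁ n m y] at h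
  linear_combination h

theorem exists_extension_coordinates {ι : Type*} [Fintype ι] [DecidableEq ι]
    (b : ι → ι → ι → ℝ) (γ : ι → ℝ)
    (h₁ : ∀ i j k, b i j k = b j i k) (h₂ : ∀ i j k, b i j k = b i k j)
    (hb : ∀ m n x y,
      (∑ a, b m x a * b n y a) + (if m = x then γ m else 0) * (if n = y then γ n else 0) =
        (∑ a, b m y a * b n x a) + (if m = y then γ m else 0) * (if n = x then γ n else 0))
    (i j : ι) (hij : i ≠ j) (hi : γ i ≠ 0) (hj : γ j ≠ 0) :
    ∃ t : ι → ℝ, ∀ m n x, γ n * b m x n + (if m = x then γ m else 0) * t n =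
      γ m * b n x m + (if n = x then γ n else 0) * t m := by
  have J := jacobi_coordinates b γ h₁ h₂ hb
  have hoff' : ∀ m n p x, p ≠ m → p ≠ n → x ≠ m → x ≠ n → γ p ≠ 0 → (γ m - γ n) * b m n x = 0 := by
    intro m n p x h1 h2 h3 h4 h5
    have h := J m n p p x
    by_cases hx : p = x
    · subst hx
      simp [h1.symm, h2.symm] at h
      rcases h with (h | h) | h
      · exact absurd h h5
      · rw [h, zero_mul]
      · rw [h, mul_zero]
    · simp [h1.symm, h2.symm, h3.symm, h4.symm, hx] at h
      rcases h with (h | h) | h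
      · exact absurd h h5
      · rw [h, zero_mul]
      · rw [h, mul_zero]
  have hex : ∀ m n, γ m = 0 ∨ γ n = 0 → ∃ p, p ≠ m ∧ p ≠ n ∧ γ p ≠ 0 := by
    intro m n h
    by_cases h1 : i = m
    · subst h1
      exact ⟨j, hij.symm, fun hh => by subst hh; tauto, hj⟩
    · by_cases h2 : i = n
      · subst h2
        exact ⟨j, fun hh => by subst hh; tauto, hij.symm, hj⟩
      · exact ⟨i, h1, h2, hi⟩
  have hoff : ∀ m n x, m ≠ n → x ≠ m → x ≠ n → (γ m - γ n) * b m n x = 0 := by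
    intro m n x h1 h2 h3
    by_cases h : γ m = 0 ∨ γ n = 0
    · obtain ⟨p, hp1, hp2, hp3⟩ := hex m n h
      exact hoff' m n p x hp1 hp2 h2 h3 hp3
    · push Not at h
      by_cases hx : γ x = 0
      · have := hoff' x n m m h2.symm h1 h2.symm h1 h.1
        rw [hx, zero_sub, neg_mul, neg_eq_zero, h₁, h₂, h₁] at this
        rw [(mul_eq_zero.1 this).resolve_left h.2, mul_zero]
      · exact hoff' m n x x h2 h3 h2 h3 hx
  have hdiag : ∀ m n p, m ≠ n → m ≠ p → n ≠ p →
      γ p * (γ n - γ m) * b m n n = γ n * (γ p - γ m) * b m p p := by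
    intro m n p h1 h2 h3
    have h := J m n p n p
    simp [h1, h2, h3, h3.symm] at h
    rw [h₁ p m p] at h
    linarith
  have hsel : ∀ m, ∃ n, n ≠ m ∧ γ n ≠ 0 := by
    intro m
    by_cases h : i = m
    · exact ⟨j, fun hm => hij (h.trans hm.symm), hj⟩
    · exact ⟨i, h, hi⟩
  choose s hs hs0 using hsel
  refine ⟨fun m => (γ (s m) - γ m) * b m (s m) (s m) / γ (s m), ?_⟩
  have ht : ∀ m n, n ≠ m → (γ n - γ m) * b m n n =
      γ n * ((γ (s m) - γ m) * b m (s m) (s m) / γ (s m)) := by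
    intro m n hn
    have := hs0 m
    field_simp
    by_cases h : n = s m
    · rw [← h]; ring
    · linarith [hdiag m n (s m) hn.symm (hs m).symm h]
  intro m n x
  by_cases hmn : m = n
  · subst hmn; rfl
  by_cases hx : m = x
  · subst hx
    have := ht n m hmn
    simp only [if_neg (Ne.symm hmn), if_true, h₂ m m n, h₁ m n m]
    linarith
  · by_cases hx' : n = x
    · subst hx'
      have := ht m n (Ne.symm hmn)
      simp only [if_neg hx, if_true, h₂ n n m, h₁ n m n]
      linarith
    · have := hoff m n x hmn (Ne.symm hx) (Ne.symm hx')
      simp only [if_neg hx, if_neg hx', h₂ m x n, h₂ n x m, h₁ n m x]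
      linarith

theorem exists_joint_eigenbasis {ι κ : Type*} [Fintype κ] [DecidableEq κ] (A : ι → Matrix κ κ ℝ)
    (hA : ∀ i, (A i).IsHermitian) (hc : ∀ i j, A i * A j = A j * A i) :
    ∃ (v : κ → κ → ℝ) (μ : κ → ι → ℝ), (∀ i k, A i *ᵥ v k = μ k i • v k) ∧
      ∀ x y : κ → ℝ, x ⬝ᵥ y = ∑ k, (x ⬝ᵥ v k) * (y ⬝ᵥ v k) := by
  classical
  let T : ι → EuclideanSpace ℝ κ →ₗ[ℝ] EuclideanSpace ℝ κ := fun i => (A i).toEuclideanLin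
  have hT : ∀ i, (T i).IsSymmetric := fun i => Matrix.isSymmetric_toEuclideanLin_iff.2 (hA i)
  have hTc : Pairwise (Function.onFun Commute T) := by
    intro i j _
    refine LinearMap.ext fun x => ?_
    simp only [T, Module.End.mul_apply, Matrix.toLpLin_apply, Matrix.mulVec_mulVec, hc i j]
  have hI := LinearMap.IsSymmetric.directSum_isInternal_of_pairwise_commute hT hTc
  have hO := LinearMap.IsSymmetric.orthogonalFamily_iInf_eigenspaces hT
  set F : (ι → ℝ) → Submodule ℝ (EuclideanSpace ℝ κ) :=
    fun α => ⨅ j, Module.End.eigenspace (T j) (α j) with hF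
  have hI' := DirectSum.isInternal_ne_bot_iff.2 hI
  have : Finite {α // F α ≠ ⊥} :=
    (Submodule.finite_ne_bot_of_iSupIndep hI.submodule_iSupIndep).to_subtype
  have := Fintype.ofFinite {α // F α ≠ ⊥}
  have hO' : OrthogonalFamily ℝ (fun i : {α // F α ≠ ⊥} => F i) fun i => (F i).subtypeₗᵢ :=
    hO.comp Subtype.val_injective
  have hn : Module.finrank ℝ (EuclideanSpace ℝ κ) = Fintype.card κ := finrank_euclideanSpace
  let b₀ := hI'.subordinateOrthonormalBasis hn hO'
  have hb₀ := fun a => hI'.subordinateOrthonormalBasis_subordinate hn a hO'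
  let σ := (Fintype.equivFin κ)
  refine ⟨fun k => (b₀ (σ k)).ofLp, fun k => (hI'.subordinateOrthonormalBasisIndex hn (σ k) hO').1,
    ?_, ?_⟩
  · intro i k
    have h := (Submodule.mem_iInf _).1 (hb₀ (σ k)) i
    rw [Module.End.mem_eigenspace_iff] at h
    exact congrArg WithLp.ofLp h
  · intro x y
    have h := (b₀.reindex σ.symm).sum_inner_mul_inner (WithLp.toLp 2 x) (WithLp.toLp 2 y)
    simp only [OrthonormalBasis.reindex_apply, Equiv.symm_symm, EuclideanSpace.inner_eq_star_dotProduct,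
      star_trivial] at h
    rw [dotProduct_comm, ← h]
    exact Finset.sum_congr rfl fun k _ => by rw [dotProduct_comm x]

theorem exists_power_sum_of_commute {ι κ : Type*} [Fintype κ] [DecidableEq κ]
    (A : ι → Matrix κ κ ℝ) (hA : ∀ i, (A i).IsHermitian) (hc : ∀ i j, A i * A j = A j * A i)
    (u : κ → ℝ) : ∃ x : κ → ι → ℝ, ∀ m n p q,
      (A m *ᵥ A p *ᵥ u) ⬝ᵥ (A n *ᵥ A q *ᵥ u) = ∑ k, x k m * x k n * x k p * x k q := by
  obtain ⟨v, μ, hv, hp⟩ := exists_joint_eigenbasis A hA hc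
  refine ⟨fun k i => √|u ⬝ᵥ v k| * μ k i, fun m n p q => ?_⟩
  have hsymm : ∀ i k y, (A i *ᵥ y) ⬝ᵥ v k = μ k i * (y ⬝ᵥ v k) := by
    intro i k y
    have hT : (A i)ᵀ = A i := hA i
    rw [dotProduct_comm, Matrix.dotProduct_mulVec, ← Matrix.mulVec_transpose, hT, hv,
      smul_dotProduct, smul_eq_mul, dotProduct_comm]
  rw [hp]
  refine Finset.sum_congr rfl fun k _ => ?_
  have hs : √|u ⬝ᵥ v k| ^ 4 = (u ⬝ᵥ v k) ^ 2 := by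
    rw [show 4 = 2 * 2 from rfl, pow_mul, Real.sq_sqrt (abs_nonneg _), sq_abs]
  simp only [hsymm]
  linear_combination (-(μ k m * μ k n * μ k p * μ k q)) * hs

/-- Coordinate form of `exists_power_sum_of_symmetric`, in a basis diagonalizing the extra
component of `w`. -/
theorem exists_power_sum_coordinates {ι : Type*} [Fintype ι] [DecidableEq ι]
    (b : ι → ι → ι → ℝ) (γ : ι → ℝ)
    (h₁ : ∀ i j k, b i j k = b j i k) (h₂ : ∀ i j k, b i j k = b i k j)
    (hb : ∀ m n x y,
      (∑ a, b m x a * b n y a) + (if m = x then γ m else 0) * (if n = y then γ n else 0) =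
        (∑ a, b m y a * b n x a) + (if m = y then γ m else 0) * (if n = x then γ n else 0))
    (l : ι → ℝ) (hl : ∀ i a, ∑ j, b i a j * l j = if i = a then 1 else 0) (hlγ : ∀ i, γ i * l i = 0) :
    ∃ x : Option ι → ι → ℝ, ∀ m n p q,
      (∑ a, b m p a * b n q a) + (if m = p then γ m else 0) * (if n = q then γ n else 0) =
        ∑ k, x k m * x k n * x k p * x k q := by
  by_cases h : ∃ i j, i ≠ j ∧ γ i ≠ 0 ∧ γ j ≠ 0
  · obtain ⟨i, j, hij, hi, hj⟩ := h
    obtain ⟨t, ht⟩ := exists_extension_coordinates b γ h₁ h₂ hb i j hij hi hj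
    let A : ι → Matrix (Option ι) (Option ι) ℝ := fun m => Matrix.of fun x y =>
      x.elim (y.elim (t m) (fun y => if m = y then γ m else 0))
        (fun x => y.elim (if m = x then γ m else 0) (fun y => b m x y))
    obtain ⟨x, hx⟩ := exists_power_sum_of_commute A
      (by
        intro i
        ext x y
        cases x <;> cases y <;> simp [A, h₂])
      (by
        intro m n
        ext x y
        rw [mul_apply, mul_apply, Fintype.sum_option, Fintype.sum_option]
        cases x with
        | none =>
          cases y with
          | none => simp [A, mul_comm]
          | some y =>
            have := ht m n y
            simp only [A, of_apply, Option.elim, mul_ite, ite_mul, mul_zero, zero_mul,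
              Finset.sum_ite_eq, Finset.mem_univ, if_true, h₂ n m y, h₂ m n y] at this ⊢
            split_ifs at this ⊢ <;> linarith
        | some x =>
          cases y with
          | none =>
            have := ht m n x
            simp only [A, of_apply, Option.elim, mul_ite, ite_mul, mul_zero, zero_mul,
              Finset.sum_ite_eq, Finset.mem_univ, if_true] at this ⊢
            split_ifs at this ⊢ <;> linarith
          | some y =>
            have := hb m n x y
            simp only [A, of_apply, Option.elim]
            simp only [h₂ n _ y, h₂ m _ y]
            rw [add_comm, this, add_comm, mul_comm]
            congr 1
            exact Finset.sum_congr rfl fun a _ => mul_comm _ _)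
      (fun o => o.elim 0 l)
    refine ⟨x, fun m n p q => ?_⟩
    rw [← hx]
    have hu : ∀ p, A p *ᵥ (fun o => o.elim 0 l) = Pi.single (some p) 1 := by
      intro p
      ext o
      cases o with
      | none => simp [A, mulVec, dotProduct, Fintype.sum_option, hlγ]
      | some x => simp [A, mulVec, dotProduct, Fintype.sum_option, hl, Pi.single_apply, eq_comm]
    rw [hu, hu, mulVec_single_one, mulVec_single_one, dotProduct, Fintype.sum_option]
    simp only [A, col_apply, of_apply, Option.elim]
    rw [add_comm]
    congr 1
    exact Finset.sum_congr rfl fun a _ => by rw [h₂ m, h₂ n]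
  · push Not at h
    have hprod : ∀ i j, i ≠ j → γ i * γ j = 0 := fun i j hij => by
      by_cases hi : γ i = 0
      · rw [hi, zero_mul]
      · rw [h i j hij hi, mul_zero]
    obtain ⟨x, hx⟩ := exists_power_sum_of_commute (fun m => Matrix.of (b m))
      (by
        intro i
        ext x y
        simp [h₂ i x y])
      (by
        intro m n
        ext x y
        rw [mul_apply, mul_apply]
        simp only [of_apply]
        have := hb m n x y
        have e₁ : (if m = x then γ m else 0) * (if n = y then γ n else 0) =
            (if m = y then γ m else 0) * (if n = x then γ n else 0) := by
          by_cases hmn : m = n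
          · subst hmn; ring
          · have := hprod m n hmn
            split_ifs <;> simp [this]
        simp only [h₂ n _ y, h₂ m _ y]
        rw [e₁] at this
        rw [add_right_cancel this]
        exact Finset.sum_congr rfl fun a _ => mul_comm _ _)
      l
    refine ⟨fun o => o.elim (fun j => √|γ j|) x, fun m n p q => ?_⟩
    rw [Fintype.sum_option, add_comm]
    simp only [Option.elim]
    rw [← hx]
    have hu : ∀ p, (Matrix.of (b p)) *ᵥ l = Pi.single p 1 := by
      intro p
      ext x
      simp [mulVec, dotProduct, hl, Pi.single_apply, eq_comm]
    rw [hu, hu, mulVec_single_one, mulVec_single_one, dotProduct]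
    simp only [col_apply, of_apply]
    congr 1
    · have hs : ∀ i j, i ≠ j → √|γ i| * √|γ j| = 0 := fun i j hij => by
        rw [← Real.sqrt_mul (abs_nonneg _), ← abs_mul, hprod i j hij, abs_zero, Real.sqrt_zero]
      by_cases hmp : m = p
      · by_cases hnq : n = q
        · subst hmp hnq
          rw [if_pos rfl, if_pos rfl]
          by_cases hmn : m = n
          · subst hmn
            have := Real.sq_sqrt (abs_nonneg (γ m))
            calc γ m * γ m = |γ m| * |γ m| := (abs_mul_abs_self _).symm
              _ = _ := by linear_combination (-(√|γ m| ^ 2 + |γ m|)) * this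
          · rw [hprod m n hmn, hs m n hmn]; ring
        · rw [if_neg hnq]
          linear_combination (-(√|γ m| * √|γ p|)) * hs n q hnq
      · rw [if_neg hmp]
        linear_combination (-(√|γ n| * √|γ q|)) * hs m p hmp
    · exact Finset.sum_congr rfl fun a _ => by rw [h₂ m, h₂ n]

theorem exists_injective_of_symmetric {V W : Type*} [AddCommGroup V] [Module ℝ V]
    [FiniteDimensional ℝ V]
    [NormedAddCommGroup W] [InnerProductSpace ℝ W] (w : V →ₗ[ℝ] V →ₗ[ℝ] W)
    (hs : ∀ m p, w m p = w p m)
    (hc : ∀ m n p q, inner ℝ (w m p) (w n q) = inner ℝ (w m n) (w p q))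
    (hnd : ∀ m, (∀ n, w m n = 0) → m = 0) : ∃ l, Function.Injective (w l) := by
  by_contra! hinj
  have step : ∀ k : ℕ, ∃ (l : V) (p : Fin k → V), LinearIndependent ℝ fun i => w l (p i) := by
    intro k
    induction k with
    | zero => exact ⟨0, 0, linearIndependent_empty_type⟩
    | succ k ih =>
      obtain ⟨l, p, hp⟩ := ih
      obtain ⟨m, hm, hm0⟩ : ∃ m, w l m = 0 ∧ m ≠ 0 := by
        have := hinj l
        rw [injective_iff_map_eq_zero] at this
        push Not at this
        exact this
      obtain ⟨l', hl'⟩ : ∃ l', w m l' ≠ 0 := by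
        by_contra! h
        exact hm0 (hnd m h)
      have hperp : ∀ q, inner ℝ (w m l') (w l q) = 0 := fun q => by
        rw [hc, hs m l, hm, inner_zero_left]
      have hli : LinearIndependent ℝ (Fin.cons (w m l') fun i => w l (p i) : Fin (k + 1) → W) := by
        rw [linearIndependent_finCons]
        refine ⟨hp, fun hmem => hl' ?_⟩
        have hle : Submodule.span ℝ (Set.range fun i => w l (p i)) ≤ (Submodule.span ℝ {w m l'})ᗮ := by
          rw [Submodule.span_le]
          rintro _ ⟨i, rfl⟩
          exact Submodule.mem_orthogonal_singleton_iff_inner_right.2 (hperp _)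
        exact inner_self_eq_zero.1 (Submodule.mem_orthogonal_singleton_iff_inner_right.1 (hle hmem))
      let g : ℝ → Fin (k + 1) → W := fun s => Fin.cons (w m l') fun i => w l (p i) + s • w l' (p i)
      have hg : Continuous g := by
        refine continuous_pi fun i => ?_
        refine Fin.cases ?_ (fun i => ?_) i
        · simpa [g] using continuous_const
        · simp only [g, Fin.cons_succ]
          fun_prop
      have hev : ∀ᶠ s in nhds (0 : ℝ), LinearIndependent ℝ (g s) := by
        refine hg.continuousAt.eventually (LinearIndependent.eventually ?_)
        simpa [g] using hli
      obtain ⟨s, hsg, hs0⟩ :=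
        ((hev.filter_mono nhdsWithin_le_nhds).and self_mem_nhdsWithin :
          ∀ᶠ s in nhdsWithin (0 : ℝ) {0}ᶜ, LinearIndependent ℝ (g s) ∧ s ∈ ({0}ᶜ : Set ℝ)).exists
      refine ⟨l + s • l', Fin.cons (s⁻¹ • m) p, ?_⟩
      convert hsg using 1
      funext i
      have hs0' : s ≠ 0 := hs0
      refine Fin.cases ?_ (fun i => ?_) i
      · simp [g, hm, hs l' m, smul_smul, hs0']
      · simp [g]
  obtain ⟨l, p, hp⟩ := step (Module.finrank ℝ V + 1)
  have := (LinearIndependent.of_comp (w l) hp).fintype_card_le_finrank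
  simp at this

theorem exists_orthonormalBasis_diagonal {H : Type*} [NormedAddCommGroup H] [InnerProductSpace ℝ H]
    [FiniteDimensional ℝ H] {N : ℕ} (hH : Module.finrank ℝ H = N) (c : H →ₗ[ℝ] H →ₗ[ℝ] ℝ)
    (hc : ∀ x y, c x y = c y x) : ∃ (f : OrthonormalBasis (Fin N) ℝ H) (γ : Fin N → ℝ),
      ∀ i j, c (f i) (f j) = if i = j then γ i else 0 := by
  let C : H →ₗ[ℝ] H := ∑ i, (c.flip (stdOrthonormalBasis ℝ H i)).smulRight (stdOrthonormalBasis ℝ H i)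
  have hC : ∀ h k : H, inner ℝ (C h) k = c h k := by
    intro h k
    conv_rhs => rw [← (stdOrthonormalBasis ℝ H).sum_repr' k, map_sum]
    rw [LinearMap.sum_apply, sum_inner]
    refine Finset.sum_congr rfl fun i _ => ?_
    rw [LinearMap.smulRight_apply, LinearMap.flip_apply, real_inner_smul_left, map_smul, smul_eq_mul,
      mul_comm]
  have hCsymm : C.IsSymmetric := fun h k => by rw [hC, real_inner_comm, hC, hc]
  refine ⟨hCsymm.eigenvectorBasis hH, hCsymm.eigenvalues hH, fun i j => ?_⟩
  rw [← hC, hCsymm.apply_eigenvectorBasis hH i, inner_smul_left,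
    orthonormal_iff_ite.1 (hCsymm.eigenvectorBasis hH).orthonormal]
  simp

/-- If the Gram tensor of a symmetric bilinear map from an `N`-dimensional space into an
`(N + 1)`-dimensional one is totally symmetric, it is a sum of `N + 1` fourth powers. -/
theorem exists_power_sum_of_symmetric {V W : Type*} [AddCommGroup V] [Module ℝ V]
    [FiniteDimensional ℝ V]
    [NormedAddCommGroup W] [InnerProductSpace ℝ W] [FiniteDimensional ℝ W] {N : ℕ}
    (hV : Module.finrank ℝ V = N) (hW : Module.finrank ℝ W = N + 1) (w : V →ₗ[ℝ] V →ₗ[ℝ] W)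
    (hs : ∀ m p, w m p = w p m)
    (hc : ∀ m n p q, inner ℝ (w m p) (w n q) = inner ℝ (w m n) (w p q))
    (hnd : ∀ m, (∀ n, w m n = 0) → m = 0) :
    ∃ x : Fin (N + 1) → V →ₗ[ℝ] ℝ, ∀ m n p q,
      inner ℝ (w m p) (w n q) = ∑ k, x k m * x k n * x k p * x k q := by
  obtain ⟨l, hl⟩ := exists_injective_of_symmetric w hs hc hnd
  let H := LinearMap.range (w l)
  have hH : Module.finrank ℝ H = N := (LinearMap.finrank_range_of_inj hl).trans hV
  let J : V ≃ₗ[ℝ] H := LinearEquiv.ofInjective (w l) hl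
  have hHo : Module.finrank ℝ Hᗮ = 1 := by
    have := H.finrank_add_finrank_orthogonal
    omega
  obtain ⟨e, he, he1⟩ : ∃ e ∈ Hᗮ, ‖e‖ = 1 := by
    have : Nontrivial Hᗮ := Module.nontrivial_of_finrank_pos (R := ℝ) (by omega)
    obtain ⟨e, he⟩ := exists_ne (0 : Hᗮ)
    have he0 : (e : W) ≠ 0 := by simpa using he
    exact ⟨(‖(e : W)‖⁻¹ : ℝ) • (e : W), Submodule.smul_mem _ _ e.2, norm_smul_inv_norm he0⟩
  have heH : ∀ p, inner ℝ e (w l p) = 0 := fun p =>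
    Submodule.inner_left_of_mem_orthogonal (LinearMap.mem_range_self _ p) he
  obtain ⟨f, γ, hfγ⟩ := exists_orthonormalBasis_diagonal hH
    ((w.compr₂ (innerₛₗ ℝ e)).compl₁₂ J.symm.toLinearMap J.symm.toLinearMap)
    (fun x y => congrArg (inner ℝ e) (hs (J.symm x) (J.symm y)))
  let v : Module.Basis (Fin N) ℝ V := f.toBasis.map J.symm
  have hv : ∀ i, v i = J.symm (f i) := fun i => by simp [v]
  have hJ : ∀ h : H, w l (J.symm h) = h := fun h => congrArg Subtype.val (J.apply_symm_apply h)
  have hf : ∀ i, w l (v i) = f i := fun i => by rw [hv, hJ]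
  have hγ : ∀ i j, inner ℝ e (w (v i) (v j)) = if i = j then γ i else 0 := by
    intro i j
    rw [hv, hv]
    exact hfγ i j
  have hff : ∀ i j, inner ℝ (w l (v i)) (w l (v j)) = if i = j then (1 : ℝ) else 0 := by
    intro i j
    rw [hf, hf]
    exact orthonormal_iff_ite.1 f.orthonormal i j
  let g : Option (Fin N) → W := fun a => a.elim e fun i => w l (v i)
  have hg : Orthonormal ℝ g := by
    rw [orthonormal_iff_ite]
    intro a b
    cases a <;> cases b <;> simp [g, hff, heH, he1, real_inner_comm e]
  let gb : OrthonormalBasis (Option (Fin N)) ℝ W :=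
    (basisOfOrthonormalOfCardEqFinrank hg (by simp [hW])).toOrthonormalBasis (by simpa using hg)
  have hgb : ∀ a, gb a = g a := fun a => by simp [gb]
  have hpar : ∀ m p n q, inner ℝ (w (v m) (v p)) (w (v n) (v q)) =
      (∑ a, inner ℝ (w (v m) (v p)) (w l (v a)) * inner ℝ (w (v n) (v q)) (w l (v a))) +
        (if m = p then γ m else 0) * (if n = q then γ n else 0) := by
    intro m p n q
    rw [← gb.sum_inner_mul_inner, Fintype.sum_option, hgb, add_comm]
    simp only [hgb, g, Option.elim]
    rw [hγ, real_inner_comm, hγ]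
    congr 1
    exact Finset.sum_congr rfl fun a _ => by rw [real_inner_comm (w l (v a)) (w (v n) (v q))]
  have hswap : ∀ m p n q, inner ℝ (w m p) (w n q) = inner ℝ (w m q) (w n p) := fun m p n q => by
    rw [hs n q, hc, hs p n]
  have hle : ∑ j, v.repr l j • v j = l := v.sum_repr l
  obtain ⟨x, hx⟩ := exists_power_sum_coordinates
    (fun i j k => inner ℝ (w (v i) (v j)) (w l (v k))) γ
    (fun i j k => by simp only [hs (v i)])
    (fun i j k => hswap _ _ _ _)
    (fun m n x y => by
      rw [← hpar, ← hpar]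
      exact hswap _ _ _ _)
    (v.repr l)
    (fun i a => by
      calc ∑ j, inner ℝ (w (v i) (v a)) (w l (v j)) * v.repr l j
          = inner ℝ (w (v i) (v a)) (w l (∑ j, v.repr l j • v j)) := by
            rw [map_sum, inner_sum]
            refine Finset.sum_congr rfl fun j _ => ?_
            rw [map_smul, real_inner_smul_right, mul_comm]
        _ = inner ℝ (w l (v i)) (w l (v a)) := by rw [hle, hs l (v i), hswap (v i) l]
        _ = _ := hff i a)
    (fun i => by
      have := heH (v i)
      rw [hs, ← hle, map_sum, inner_sum] at this
      simp only [map_smul, real_inner_smul_right, hγ, mul_ite, mul_zero, Finset.sum_ite_eq,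
        Finset.mem_univ, if_true] at this
      rwa [mul_comm])
  have hlin : ∀ {φ ψ : V → ℝ}, IsLinearMap ℝ φ → IsLinearMap ℝ ψ → (∀ i, φ (v i) = ψ (v i)) →
      ∀ m, φ m = ψ m := by
    intro φ ψ hφ hψ h m
    exact congrArg (fun F : V →ₗ[ℝ] ℝ => F m)
      (v.ext (f₁ := hφ.mk' φ) (f₂ := hψ.mk' ψ) h)
  obtain ⟨X, hX⟩ : ∃ X : Option (Fin N) → V →ₗ[ℝ] ℝ, ∀ k i, X k (v i) = x k i :=
    ⟨fun k => v.constr ℝ (x k), fun k i => v.constr_basis ℝ (x k) i⟩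
  refine ⟨fun k => X (finSuccEquiv N k), fun m n p q => ?_⟩
  rw [(finSuccEquiv N).sum_comp fun k => X k m * X k n * X k p * X k q]
  revert m
  refine hlin ⟨?_, ?_⟩ ⟨?_, ?_⟩ fun m => ?_
  · intro a b; simp only [map_add, LinearMap.add_apply, inner_add_left]
  · intro a b; simp only [map_smul, LinearMap.smul_apply, real_inner_smul_left, smul_eq_mul]
  · intro a b; simp only [map_add, add_mul, Finset.sum_add_distrib]
  · intro a b
    simp only [map_smul, smul_eq_mul, Finset.mul_sum]
    exact Finset.sum_congr rfl fun k _ => by ring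
  revert n
  refine hlin ⟨?_, ?_⟩ ⟨?_, ?_⟩ fun n => ?_
  · intro a b; simp only [map_add, LinearMap.add_apply, inner_add_right]
  · intro a b; simp only [map_smul, LinearMap.smul_apply, real_inner_smul_right, smul_eq_mul]
  · intro a b; simp only [map_add, add_mul, mul_add, Finset.sum_add_distrib]
  · intro a b
    simp only [map_smul, smul_eq_mul, Finset.mul_sum]
    exact Finset.sum_congr rfl fun k _ => by ring
  revert p
  refine hlin ⟨?_, ?_⟩ ⟨?_, ?_⟩ fun p => ?_
  · intro a b; simp only [map_add, inner_add_left]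
  · intro a b; simp only [map_smul, real_inner_smul_left, smul_eq_mul]
  · intro a b; simp only [map_add, add_mul, mul_add, Finset.sum_add_distrib]
  · intro a b
    simp only [map_smul, smul_eq_mul, Finset.mul_sum]
    exact Finset.sum_congr rfl fun k _ => by ring
  revert q
  refine hlin ⟨?_, ?_⟩ ⟨?_, ?_⟩ fun q => ?_
  · intro a b; simp only [map_add, inner_add_right]
  · intro a b; simp only [map_smul, real_inner_smul_right, smul_eq_mul]
  · intro a b; simp only [map_add, mul_add, Finset.sum_add_distrib]
  · intro a b
    simp only [map_smul, smul_eq_mul, Finset.mul_sum]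
    exact Finset.sum_congr rfl fun k _ => by ring
  simp only [hpar, hx, hX]

/-- The coordinate vector of the elementary tensor `m ⊗ p`. -/
def tensorVec {N : ℕ} (m p : Fin N → ℝ) : Fin N × Fin N → ℝ := fun a => m a.1 * p a.2

theorem tensorVec_dotProduct_mulVec {N : ℕ} (ρ : Matrix (Fin N × Fin N) (Fin N × Fin N) ℝ)
    (m p n q : Fin N → ℝ) :
    tensorVec m p ⬝ᵥ ρ *ᵥ tensorVec n q =
      ∑ i, ∑ k, ∑ j, ∑ l, m i * p k * n j * q l * ρ (i, k) (j, l) := by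
  simp only [dotProduct, mulVec, Fintype.sum_prod_type, tensorVec, Finset.mul_sum]
  refine Finset.sum_congr rfl fun i _ => Finset.sum_congr rfl fun k _ =>
    Finset.sum_congr rfl fun j _ => Finset.sum_congr rfl fun l _ => ?_
  ring

namespace CompletelySymmetric

variable {N : ℕ} {ρ : Matrix (Fin N × Fin N) (Fin N × Fin N) ℝ}

theorem apply_swap_left (h : CompletelySymmetric ρ) (i j k l : Fin N) :
    ρ (k, i) (j, l) = ρ (i, k) (j, l) :=
  h (Equiv.swap 0 2) ![i, j, k, l]

theorem apply_swap_middle (h : CompletelySymmetric ρ) (i j k l : Fin N) :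
    ρ (i, j) (k, l) = ρ (i, k) (j, l) :=
  h (Equiv.swap 1 2) ![i, j, k, l]

theorem tensorVec_swap_left (h : CompletelySymmetric ρ) (m p n q : Fin N → ℝ) :
    tensorVec m p ⬝ᵥ ρ *ᵥ tensorVec n q = tensorVec p m ⬝ᵥ ρ *ᵥ tensorVec n q := by
  rw [tensorVec_dotProduct_mulVec, tensorVec_dotProduct_mulVec, Finset.sum_comm]
  refine Finset.sum_congr rfl fun i _ => Finset.sum_congr rfl fun k _ =>
    Finset.sum_congr rfl fun j _ => Finset.sum_congr rfl fun l _ => ?_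
  rw [h.apply_swap_left i j k l]
  ring

theorem tensorVec_swap_middle (h : CompletelySymmetric ρ) (m p n q : Fin N → ℝ) :
    tensorVec m p ⬝ᵥ ρ *ᵥ tensorVec n q = tensorVec m n ⬝ᵥ ρ *ᵥ tensorVec p q := by
  rw [tensorVec_dotProduct_mulVec, tensorVec_dotProduct_mulVec]
  refine Finset.sum_congr rfl fun i _ => ?_
  rw [Finset.sum_comm]
  refine Finset.sum_congr rfl fun j _ => Finset.sum_congr rfl fun k _ =>
    Finset.sum_congr rfl fun l _ => ?_
  rw [h.apply_swap_middle i j k l]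
  ring

end CompletelySymmetric

theorem reducedMat_mulVec {N : ℕ} (ρ : Matrix (Fin N × Fin N) (Fin N × Fin N) ℝ)
    (m : Fin N → ℝ) (i : Fin N) :
    (reducedMat ρ *ᵥ m) i = ∑ k, (ρ *ᵥ tensorVec m (Pi.single k 1)) (i, k) := by
  simp only [reducedMat, mulVec, dotProduct, Matrix.of_apply, tensorVec, Fintype.sum_prod_type,
    Pi.single_apply, mul_ite, mul_one, mul_zero, Finset.sum_ite_eq', Finset.mem_univ, if_true,
    Finset.sum_mul]
  rw [Finset.sum_comm]

theorem mulVec_eq_zero_of_rank_eq {n : Type*} [Fintype n] [DecidableEq n] {M : Matrix n n ℝ}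
    (h : M.rank = Fintype.card n) {m : n → ℝ} (hm : M *ᵥ m = 0) : m = 0 := by
  have := LinearMap.finrank_range_add_finrank_ker M.mulVecLin
  rw [Module.finrank_fintype_fun_eq_card] at this
  have hk : Module.finrank ℝ (LinearMap.ker M.mulVecLin) = 0 := by
    have : M.rank = Module.finrank ℝ (LinearMap.range M.mulVecLin) := rfl
    omega
  have hb := Submodule.finrank_eq_zero.mp hk
  have : m ∈ LinearMap.ker M.mulVecLin := by simpa using hm
  rw [hb] at this
  simpa using this

theorem vecMulVec_kronecker_self {N : ℕ} (x : Fin N → ℝ) :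
    vecMulVec x x ⊗ₖ vecMulVec x x = vecMulVec (tensorVec x x) (tensorVec x x) := by
  ext a b
  simp only [kroneckerMap_apply, vecMulVec_apply, tensorVec]
  ring

open scoped MatrixOrder in
theorem Matrix.PosSemidef.exists_eq_transpose_mul_self {n : Type*} [Fintype n] [DecidableEq n]
    {M : Matrix n n ℝ} (h : M.PosSemidef) : ∃ B : Matrix n n ℝ, M = Bᵀ * B := by
  classical
  obtain ⟨B, hB⟩ := CStarAlgebra.nonneg_iff_eq_star_mul_self.mp h.nonneg
  exact ⟨B, by simpa [Matrix.star_eq_conjTranspose] using hB⟩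

theorem exists_eq_sum_of_rank_eq_succ {N : ℕ} (ρ : Matrix (Fin N × Fin N) (Fin N × Fin N) ℝ)
    (hcs : CompletelySymmetric ρ) (hpsd : ρ.PosSemidef)
    (hsupp : (reducedMat ρ).rank = N) (hrank : ρ.rank = N + 1) :
    ∃ x : Fin (N + 1) → Fin N → ℝ,
      ρ = ∑ t, vecMulVec (x t) (x t) ⊗ₖ vecMulVec (x t) (x t) := by
  obtain ⟨B, hB⟩ := hpsd.exists_eq_transpose_mul_self
  let f := Matrix.toEuclideanLin B
  have hfin : Module.finrank ℝ (LinearMap.range f) = N + 1 := by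
    rw [← hrank, hB, Matrix.rank_transpose_mul_self]
    exact (Matrix.rank_eq_finrank_range_toLin B (EuclideanSpace.basisFun _ ℝ).toBasis
      (EuclideanSpace.basisFun _ ℝ).toBasis).symm
  let w : (Fin N → ℝ) →ₗ[ℝ] (Fin N → ℝ) →ₗ[ℝ] LinearMap.range f :=
    LinearMap.mk₂ ℝ (fun m p => f.rangeRestrict (WithLp.toLp 2 (tensorVec m p)))
      (fun m₁ m₂ p => by
        rw [← map_add]; congr 1; ext a; simp [tensorVec, add_mul])
      (fun c m p => by
        rw [← map_smul]; congr 1; ext a; simp [tensorVec, mul_assoc])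
      (fun m p₁ p₂ => by
        rw [← map_add]; congr 1; ext a; simp [tensorVec, mul_add])
      (fun c m p => by
        rw [← map_smul]; congr 1; ext a; simp [tensorVec, mul_left_comm])
  have hw : ∀ m p n q, inner ℝ (w m p) (w n q) = tensorVec m p ⬝ᵥ ρ *ᵥ tensorVec n q := by
    intro m p n q
    have h1 : inner ℝ (w m p) (w n q) = (B *ᵥ tensorVec n q) ⬝ᵥ (B *ᵥ tensorVec m p) := by
      rfl
    rw [h1, hB, dotProduct_comm, ← Matrix.mulVec_mulVec, Matrix.dotProduct_mulVec _ Bᵀ,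
      Matrix.vecMul_transpose]
  have hs : ∀ m p, w m p = w p m := by
    intro m p
    rw [← sub_eq_zero, ← inner_self_eq_zero (𝕜 := ℝ)]
    simp only [inner_sub_left, inner_sub_right, hw]
    rw [hcs.tensorVec_swap_left p m m p, hcs.tensorVec_swap_left p m p m]
    ring
  have hc : ∀ m n p q, inner ℝ (w m p) (w n q) = inner ℝ (w m n) (w p q) := by
    intro m n p q
    rw [hw, hw, hcs.tensorVec_swap_middle]
  have hnd : ∀ m, (∀ n, w m n = 0) → m = 0 := by
    intro m hm
    refine mulVec_eq_zero_of_rank_eq (by simpa using hsupp) (funext fun i => ?_)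
    rw [reducedMat_mulVec]
    refine Finset.sum_eq_zero fun k _ => ?_
    have h0 : B *ᵥ tensorVec m (Pi.single k 1) = 0 := by
      have := congrArg (fun v : LinearMap.range f => WithLp.ofLp v.1) (hm (Pi.single k 1))
      exact this
    rw [hB, ← Matrix.mulVec_mulVec, h0]
    simp
  obtain ⟨X, hX⟩ := exists_power_sum_of_symmetric (Module.finrank_fin_fun ℝ) hfin w hs hc hnd
  refine ⟨fun t i => X t (Pi.single i 1), ?_⟩
  ext ⟨i, k⟩ ⟨j, l⟩
  have h1 := hX (Pi.single i 1) (Pi.single j 1) (Pi.single k 1) (Pi.single l 1)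
  rw [hw] at h1
  have h2 : ∀ i k : Fin N, tensorVec (Pi.single i 1) (Pi.single k 1) = Pi.single (i, k) 1 := by
    intro i k
    ext ⟨a, b⟩
    simp only [tensorVec, Pi.single_apply, Prod.mk.injEq]
    by_cases h : a = i <;> by_cases h3 : b = k <;> simp [h, h3]
  rw [h2, h2] at h1
  simp only [Matrix.mulVec_single_one, single_one_dotProduct, Matrix.col_apply] at h1
  rw [h1, Matrix.sum_apply]
  refine Finset.sum_congr rfl fun t _ => ?_
  exact mul_assoc _ _ _

theorem dotProduct_reducedMat_mulVec {N : ℕ} (ρ : Matrix (Fin N × Fin N) (Fin N × Fin N) ℝ)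
    (m : Fin N → ℝ) :
    m ⬝ᵥ reducedMat ρ *ᵥ m =
      ∑ k, tensorVec m (Pi.single k 1) ⬝ᵥ ρ *ᵥ tensorVec m (Pi.single k 1) := by
  simp only [dotProduct, reducedMat_mulVec, Fintype.sum_prod_type, tensorVec, Finset.mul_sum,
    Pi.single_apply, mul_ite, mul_one, mul_zero, ite_mul, zero_mul, Finset.sum_ite_eq',
    Finset.mem_univ, if_true]
  rw [Finset.sum_comm]

theorem Matrix.PosSemidef.mulVec_tensorVec_eq_zero {N : ℕ}
    {σ : Matrix (Fin N × Fin N) (Fin N × Fin N) ℝ} (h : σ.PosSemidef) {φ : Fin N → ℝ}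
    (hφ : φ ⬝ᵥ reducedMat σ *ᵥ φ = 0) (ψ : Fin N → ℝ) : σ *ᵥ tensorVec φ ψ = 0 := by
  rw [dotProduct_reducedMat_mulVec, Finset.sum_eq_zero_iff_of_nonneg] at hφ
  · have hk : ∀ k, σ *ᵥ tensorVec φ (Pi.single k 1) = 0 := fun k =>
      (h.dotProduct_mulVec_zero_iff _).mp (by simpa using hφ k (Finset.mem_univ k))
    have : tensorVec φ ψ = ∑ k, ψ k • tensorVec φ (Pi.single k 1) := by
      ext ⟨a, b⟩
      simp [tensorVec, Finset.sum_apply, Pi.single_apply, mul_comm]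
    rw [this, Matrix.mulVec_sum]
    simp [Matrix.mulVec_smul, hk]
  · intro k _
    simpa using h.dotProduct_mulVec_nonneg (tensorVec φ (Pi.single k 1))

theorem CompletelySymmetric.dotProduct_mulVec_tensorVec_eq_zero {N : ℕ}
    {σ δ : Matrix (Fin N × Fin N) (Fin N × Fin N) ℝ} (h : CompletelySymmetric (σ + δ))
    (hσ : σ.PosSemidef) (hδ : δ.PosSemidef) {φ ψ : Fin N → ℝ}
    (hφ : φ ⬝ᵥ reducedMat σ *ᵥ φ = 0) (hψ : ψ ⬝ᵥ reducedMat δ *ᵥ ψ = 0) :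
    tensorVec φ ψ ⬝ᵥ (σ + δ) *ᵥ tensorVec φ ψ = 0 := by
  have hσ0 := hσ.mulVec_tensorVec_eq_zero hφ ψ
  have hδ0 := hδ.mulVec_tensorVec_eq_zero hψ φ
  set a := tensorVec φ ψ - tensorVec ψ φ with ha
  have h0 : a ⬝ᵥ (σ + δ) *ᵥ a = 0 := by
    rw [ha, Matrix.mulVec_sub, dotProduct_sub, sub_dotProduct, sub_dotProduct,
      h.tensorVec_swap_left φ ψ φ ψ, h.tensorVec_swap_left φ ψ ψ φ]
    ring
  rw [Matrix.add_mulVec, dotProduct_add] at h0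
  have h1 : 0 ≤ a ⬝ᵥ σ *ᵥ a := by simpa using hσ.dotProduct_mulVec_nonneg a
  have h2 : 0 ≤ a ⬝ᵥ δ *ᵥ a := by simpa using hδ.dotProduct_mulVec_nonneg a
  have h3 : δ *ᵥ a = 0 :=
    (hδ.dotProduct_mulVec_zero_iff a).mp (by simpa using le_antisymm (by linarith) h2)
  have h4 : δ *ᵥ tensorVec φ ψ = 0 := by
    rwa [ha, Matrix.mulVec_sub, hδ0, sub_zero] at h3
  rw [Matrix.add_mulVec, hσ0, h4]
  simp

theorem tensorVec_dotProduct_tensorVec {N : ℕ} (φ ψ x y : Fin N → ℝ) :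
    tensorVec φ ψ ⬝ᵥ tensorVec x y = (φ ⬝ᵥ x) * (ψ ⬝ᵥ y) := by
  simp only [dotProduct, tensorVec, Fintype.sum_prod_type, Finset.sum_mul_sum]
  refine Finset.sum_congr rfl fun i _ => Finset.sum_congr rfl fun k _ => ?_
  ring

theorem exists_dotProduct_eq_zero_of_notMem {n : Type*} [Fintype n] [DecidableEq n]
    {U : Submodule ℝ (n → ℝ)} {x : n → ℝ} (h : x ∉ U) :
    ∃ φ : n → ℝ, φ ⬝ᵥ x ≠ 0 ∧ ∀ u ∈ U, φ ⬝ᵥ u = 0 := by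
  obtain ⟨f, hf, hU⟩ := Submodule.exists_le_ker_of_notMem h
  have hd : ∀ u, (fun i => f (Pi.single i 1)) ⬝ᵥ u = f u := by
    intro u
    conv_rhs => rw [LinearMap.pi_apply_eq_sum_univ f u]
    simp only [dotProduct, smul_eq_mul]
    refine Finset.sum_congr rfl fun i _ => ?_
    rw [mul_comm]
    congr 2
    ext j
    simp [Pi.single_apply, eq_comm]
  refine ⟨fun i => f (Pi.single i 1), by rwa [hd], fun u hu => ?_⟩
  rw [hd]
  exact hU hu

theorem mulVec_mem_colSpace {n : Type*} [Fintype n] [DecidableEq n] (M : Matrix n n ℝ)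
    (v : n → ℝ) : M *ᵥ v ∈ colSpace M :=
  ⟨v, Matrix.toLin'_apply M v⟩

theorem finrank_colSpace {n : Type*} [Fintype n] [DecidableEq n] (M : Matrix n n ℝ) :
    Module.finrank ℝ (colSpace M) = M.rank := by
  rw [colSpace, Matrix.toLin'_apply', Matrix.rank]

theorem mem_colSpace_or_mem_colSpace {ι : Type*} [Fintype ι] {N : ℕ} {x : ι → Fin N → ℝ}
    {σ δ : Matrix (Fin N × Fin N) (Fin N × Fin N) ℝ} (h : CompletelySymmetric (σ + δ))
    (hσ : σ.PosSemidef) (hδ : δ.PosSemidef)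
    (hx : σ + δ = ∑ t, vecMulVec (x t) (x t) ⊗ₖ vecMulVec (x t) (x t)) (t : ι) :
    x t ∈ colSpace (reducedMat σ) ∨ x t ∈ colSpace (reducedMat δ) := by
  by_contra! hc
  obtain ⟨φ, hφt, hφ⟩ := exists_dotProduct_eq_zero_of_notMem hc.1
  obtain ⟨ψ, hψt, hψ⟩ := exists_dotProduct_eq_zero_of_notMem hc.2
  have h0 := h.dotProduct_mulVec_tensorVec_eq_zero hσ hδ (hφ _ (mulVec_mem_colSpace _ _))
    (hψ _ (mulVec_mem_colSpace _ _))
  have h1 : tensorVec φ ψ ⬝ᵥ (σ + δ) *ᵥ tensorVec φ ψ =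
      ∑ s, ((φ ⬝ᵥ x s) * (ψ ⬝ᵥ x s)) ^ 2 := by
    rw [hx, Matrix.sum_mulVec, dotProduct_sum]
    refine Finset.sum_congr rfl fun s _ => ?_
    rw [vecMulVec_kronecker_self, Matrix.vecMulVec_mulVec, dotProduct_smul,
      dotProduct_comm (tensorVec (x s) (x s)), tensorVec_dotProduct_tensorVec]
    simp [pow_two]
  rw [h1, Finset.sum_eq_zero_iff_of_nonneg fun _ _ => sq_nonneg _] at h0
  exact mul_ne_zero hφt hψt (pow_eq_zero_iff two_ne_zero |>.mp (h0 t (Finset.mem_univ t)))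

theorem Matrix.PosSemidef.colSpace_reducedMat_ne_bot {N : ℕ}
    {σ : Matrix (Fin N × Fin N) (Fin N × Fin N) ℝ} (h : σ.PosSemidef) (h0 : σ ≠ 0) :
    colSpace (reducedMat σ) ≠ ⊥ := by
  intro hb
  have h1 : reducedMat σ = 0 := by
    rwa [colSpace, LinearMap.range_eq_bot, LinearEquiv.map_eq_zero_iff] at hb
  refine h0 (h.trace_eq_zero_iff.mp ?_)
  have h2 : σ.trace = (reducedMat σ).trace := by
    simp [Matrix.trace, reducedMat, Fintype.sum_prod_type]
  rw [h2, h1, Matrix.trace_zero]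

theorem exists_finrank_span_compl_lt_of_card_add_finrank_le {ι E : Type*} [Fintype ι]
    [DecidableEq ι] [AddCommGroup E] [Module ℝ E] [FiniteDimensional ℝ E] {x : ι → E}
    (hx : Submodule.span ℝ (Set.range x) = ⊤) {V : Submodule ℝ E} {A : Finset ι}
    (hA : ∀ t, t ∉ A → x t ∈ V) (hcard : A.card + Module.finrank ℝ V ≤ Module.finrank ℝ E)
    (hV : Module.finrank ℝ V < Module.finrank ℝ E) :
    ∃ j, Module.finrank ℝ (Submodule.span ℝ (x '' {j}ᶜ)) < Module.finrank ℝ E := by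
  classical
  obtain rfl | ⟨j, hj⟩ := A.eq_empty_or_nonempty
  · have : (⊤ : Submodule ℝ E) ≤ V := by
      rw [← hx, Submodule.span_le]
      rintro _ ⟨t, rfl⟩
      exact hA t (Finset.notMem_empty t)
    rw [top_le_iff.mp this, finrank_top] at hV
    exact absurd hV (lt_irrefl _)
  · refine ⟨j, ?_⟩
    have h1 : Submodule.span ℝ (x '' {j}ᶜ) ≤
        V ⊔ Submodule.span ℝ ((A.erase j).image x : Finset E) := by
      rw [Submodule.span_le]
      rintro _ ⟨t, ht, rfl⟩
      by_cases htA : t ∈ A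
      · exact Submodule.mem_sup_right (Submodule.subset_span
          (Finset.mem_coe.mpr (Finset.mem_image_of_mem x (Finset.mem_erase.mpr ⟨ht, htA⟩))))
      · exact Submodule.mem_sup_left (hA t htA)
    have h2 := Submodule.finrank_mono h1
    have h3 := Submodule.finrank_add_le_finrank_add_finrank V
      (Submodule.span ℝ ((A.erase j).image x : Finset E))
    have h4 := finrank_span_finset_le_card (R := ℝ) ((A.erase j).image x)
    rw [Set.finrank] at h4
    have h5 : ((A.erase j).image x).card ≤ (A.erase j).card := Finset.card_image_le
    have h6 := Finset.card_erase_add_one hj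
    omega

theorem exists_finrank_span_compl_lt {ι E : Type*} [Fintype ι]
    [DecidableEq ι] [AddCommGroup E] [Module ℝ E] [FiniteDimensional ℝ E] {x : ι → E}
    (hx : Submodule.span ℝ (Set.range x) = ⊤)
    (hcard : Fintype.card ι = Module.finrank ℝ E + 1) {U V : Submodule ℝ E}
    (hU : U ≠ ⊥) (hV : V ≠ ⊥)
    (hUV : Module.finrank ℝ U + Module.finrank ℝ V = Module.finrank ℝ E)
    (hmem : ∀ t, x t ∈ U ∨ x t ∈ V) :
    ∃ j, Module.finrank ℝ (Submodule.span ℝ (x '' {j}ᶜ)) < Module.finrank ℝ E := by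
  classical
  have hU0 : Module.finrank ℝ U ≠ 0 := fun h => hU (Submodule.finrank_eq_zero.mp h)
  have hV0 : Module.finrank ℝ V ≠ 0 := fun h => hV (Submodule.finrank_eq_zero.mp h)
  set S := Finset.univ.filter fun t => x t ∈ U with hS
  have hsum : S.card + Sᶜ.card = Fintype.card ι := Finset.card_add_card_compl S
  by_cases hle : S.card ≤ Module.finrank ℝ U
  · refine exists_finrank_span_compl_lt_of_card_add_finrank_le hx (V := V) (A := S)
      (fun t ht => (hmem t).resolve_left ?_) (by omega) (by omega)
    simpa [hS] using ht
  · refine exists_finrank_span_compl_lt_of_card_add_finrank_le hx (V := U) (A := Sᶜ)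
      (fun t ht => ?_) (by omega) (by omega)
    simpa [hS] using ht

theorem Matrix.rank_add_le_rank_add_rank {m n : Type*} [Fintype m] [Fintype n]
    (A B : Matrix m n ℝ) : (A + B).rank ≤ A.rank + B.rank := by
  refine (Submodule.finrank_mono ?_).trans (Submodule.finrank_add_le_finrank_add_finrank
    (LinearMap.range A.mulVecLin) (LinearMap.range B.mulVecLin))
  rintro _ ⟨v, rfl⟩
  rw [Matrix.mulVecLin_add]
  exact Submodule.add_mem_sup ⟨v, rfl⟩ ⟨v, rfl⟩

theorem Matrix.rank_sum_vecMulVec_le_card {ι n : Type*} [Fintype n] [DecidableEq ι]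
    (s : Finset ι) (u v : ι → n → ℝ) : (∑ t ∈ s, vecMulVec (u t) (v t)).rank ≤ s.card := by
  induction s using Finset.induction_on with
  | empty => simp
  | insert a s ha ih =>
    rw [Finset.sum_insert ha, Finset.card_insert_of_notMem ha]
    have := Matrix.rank_add_le_rank_add_rank (vecMulVec (u a) (v a))
      (∑ t ∈ s, vecMulVec (u t) (v t))
    have := Matrix.rank_vecMulVec_le (u a) (v a)
    omega

theorem reducedMat_add {N : ℕ} (σ δ : Matrix (Fin N × Fin N) (Fin N × Fin N) ℝ) :
    reducedMat (σ + δ) = reducedMat σ + reducedMat δ := by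
  ext i j
  simp [reducedMat, Finset.sum_add_distrib]

theorem reducedMat_sum {N : ℕ} {ι : Type*} (s : Finset ι)
    (f : ι → Matrix (Fin N × Fin N) (Fin N × Fin N) ℝ) :
    reducedMat (∑ t ∈ s, f t) = ∑ t ∈ s, reducedMat (f t) := by
  ext i j
  simp only [reducedMat, Matrix.of_apply, Matrix.sum_apply]
  rw [Finset.sum_comm]

theorem reducedMat_vecMulVec_kronecker {N : ℕ} (x : Fin N → ℝ) :
    reducedMat (vecMulVec x x ⊗ₖ vecMulVec x x) = vecMulVec ((x ⬝ᵥ x) • x) x := by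
  ext i j
  simp only [reducedMat, Matrix.of_apply, kroneckerMap_apply, vecMulVec_apply, Pi.smul_apply,
    smul_eq_mul, ← Finset.mul_sum]
  simp only [dotProduct]
  ring

theorem rank_reducedMat_sum_le {N : ℕ} {ι : Type*} (s : Finset ι) (x : ι → Fin N → ℝ) :
    (reducedMat (∑ t ∈ s, vecMulVec (x t) (x t) ⊗ₖ vecMulVec (x t) (x t))).rank ≤
      Module.finrank ℝ (Submodule.span ℝ (x '' s)) := by
  rw [Matrix.rank]
  refine Submodule.finrank_mono ?_
  rintro _ ⟨v, rfl⟩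
  rw [Matrix.mulVecLin_apply, reducedMat_sum, Matrix.sum_mulVec]
  refine Submodule.sum_mem _ fun t ht => ?_
  rw [reducedMat_vecMulVec_kronecker, Matrix.vecMulVec_mulVec]
  have : x t ∈ Submodule.span ℝ (x '' s) := Submodule.subset_span ⟨t, ht, rfl⟩
  simpa using Submodule.smul_mem _ _ (Submodule.smul_mem _ (x t ⬝ᵥ x t) this)

theorem completelySymmetric_sum {N : ℕ} {ι : Type*} (s : Finset ι) (x : ι → Fin N → ℝ) :
    CompletelySymmetric (∑ t ∈ s, vecMulVec (x t) (x t) ⊗ₖ vecMulVec (x t) (x t)) := by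
  intro π v
  simp only [Matrix.sum_apply]
  refine Finset.sum_congr rfl fun t _ => ?_
  have h := Equiv.prod_comp π fun a => x t (v a)
  simp only [Fin.prod_univ_four] at h
  simp only [kroneckerMap_apply, vecMulVec_apply]
  linear_combination h

theorem posSemidef_sum_vecMulVec_kronecker {N : ℕ} {ι : Type*} (s : Finset ι)
    (x : ι → Fin N → ℝ) :
    (∑ t ∈ s, vecMulVec (x t) (x t) ⊗ₖ vecMulVec (x t) (x t)).PosSemidef := by
  refine Matrix.posSemidef_sum s fun t _ => ?_
  rw [vecMulVec_kronecker_self]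
  simpa using Matrix.posSemidef_vecMulVec_self_star (tensorVec (x t) (x t))

/-- A completely symmetric state supported on `ℝ^N ⊗ ℝ^N` (`N > 3`) of rank `N+1` is
S-separable if it is irreducible; if it is reducible then it is the sum of a completely
symmetric positive semidefinite matrix of rank `N` supported on an `(N-1)⊗(N-1)` subspace
and a symmetric pure product term `(x xᵀ) ⊗ (x xᵀ)`. -/
theorem completelySymmetric_rank_succ {N : ℕ} (hN : 3 < N)
    (ρ : Matrix (Fin N × Fin N) (Fin N × Fin N) ℝ)
    (hcs : CompletelySymmetric ρ) (hpsd : ρ.PosSemidef) (htr : ρ.trace = 1)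
    (hsupp : (reducedMat ρ).rank = N) (hrank : ρ.rank = N + 1) :
    (¬ Reducible ρ → SSeparable ρ) ∧
    (Reducible ρ →
      ∃ (x : Fin N → ℝ) (σ : Matrix (Fin N × Fin N) (Fin N × Fin N) ℝ),
        ρ = σ + vecMulVec x x ⊗ₖ vecMulVec x x ∧
        CompletelySymmetric σ ∧ σ.PosSemidef ∧ σ.rank = N ∧
        (reducedMat σ).rank = N - 1) := by
  obtain ⟨x, hx⟩ := exists_eq_sum_of_rank_eq_succ ρ hcs hpsd hsupp hrank
  refine ⟨fun _ => ⟨N + 1, x, hx⟩, ?_⟩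
  rintro ⟨σ, δ, hσ, hδ, hσ0, hδ0, hρ, hsup, hinf⟩
  have hspan : Submodule.span ℝ (Set.range x) = ⊤ := by
    apply Submodule.eq_top_of_finrank_eq
    have h1 := rank_reducedMat_sum_le Finset.univ x
    rw [← hx, hsupp, Finset.coe_univ, Set.image_univ] at h1
    refine le_antisymm (Submodule.finrank_le _) ?_
    rwa [Module.finrank_fin_fun]
  have hdim := Submodule.finrank_sup_add_finrank_inf_eq (colSpace (reducedMat σ))
    (colSpace (reducedMat δ))
  rw [hinf, finrank_bot, ← hsup, finrank_colSpace (reducedMat ρ), hsupp, add_zero] at hdim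
  obtain ⟨j, hj⟩ := exists_finrank_span_compl_lt hspan (by simp)
    (hσ.colSpace_reducedMat_ne_bot hσ0) (hδ.colSpace_reducedMat_ne_bot hδ0)
    (by rw [← hdim, Module.finrank_fin_fun])
    (mem_colSpace_or_mem_colSpace (hρ ▸ hcs) hσ hδ (hρ ▸ hx))
  rw [Module.finrank_fin_fun] at hj
  set τ := ∑ t ∈ Finset.univ.erase j, vecMulVec (x t) (x t) ⊗ₖ vecMulVec (x t) (x t) with hτ
  have hsplit : ρ = τ + vecMulVec (x j) (x j) ⊗ₖ vecMulVec (x j) (x j) := by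
    rw [hx, hτ, Finset.sum_erase_add _ _ (Finset.mem_univ j)]
  have hle : τ.rank ≤ N := by
    have := Matrix.rank_sum_vecMulVec_le_card (Finset.univ.erase j)
      (fun t => tensorVec (x t) (x t)) (fun t => tensorVec (x t) (x t))
    simp only [← vecMulVec_kronecker_self, Finset.card_erase_of_mem (Finset.mem_univ j),
      Finset.card_univ, Fintype.card_fin, Nat.add_sub_cancel] at this
    exact this
  have hge : N + 1 ≤ τ.rank + 1 := by
    have h1 := Matrix.rank_add_le_rank_add_rank τ (vecMulVec (x j) (x j) ⊗ₖ vecMulVec (x j) (x j))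
    rw [← hsplit, hrank, vecMulVec_kronecker_self] at h1
    exact h1.trans (Nat.add_le_add_left (Matrix.rank_vecMulVec_le _ _) _)
  have hle₁ : (reducedMat τ).rank < N := by
    refine (rank_reducedMat_sum_le _ x).trans_lt ?_
    rwa [Finset.coe_erase, Finset.coe_univ, ← Set.compl_eq_univ_sdiff]
  have hge₁ : N ≤ (reducedMat τ).rank + 1 := by
    have h1 := Matrix.rank_add_le_rank_add_rank (reducedMat τ)
      (reducedMat (vecMulVec (x j) (x j) ⊗ₖ vecMulVec (x j) (x j)))
    rw [← reducedMat_add, ← hsplit, hsupp, reducedMat_vecMulVec_kronecker] at h1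
    exact h1.trans (Nat.add_le_add_left (Matrix.rank_vecMulVec_le _ _) _)
  exact ⟨x j, τ, hsplit, completelySymmetric_sum _ x, posSemidef_sum_vecMulVec_kronecker _ x,
    by omega, by omega⟩
end

section
/- Let N > 3 and let ρ be a completely symmetric state on ℝ^N ⊗ ℝ^N, supported on ℝ^N ⊗ ℝ^N, with rank(ρ) = N + 1. Then either ρ = Σ_{t=1}^{N+1} (x_t x_tᵀ) ⊗ (x_t x_tᵀ) for some vectors x_1, …, x_{N+1} ∈ ℝ^N, or ρ = σ + Σ_{i=1}^{N−3} (x_i x_iᵀ) ⊗ (x_i x_iᵀ) where σ is a completely symmetric positive semidefinite matrix of rank 4 whose reduced matrix σ₁ has rank 3 (σ is supported in a 3⊗3 subspace) and each x_i is orthogonal to the column space of σ₁. -/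
open Matrix
open Kronecker
open scoped BigOperators

open Module.End in
/-- A vector moved by a commuting family of symmetric operators has a quartic moment form which is
a sum of at most `finrank` fourth powers. -/
theorem LinearMap.IsSymmetric.exists_inner_eq_sum_of_pairwise_commute {ι E : Type*}
    [NormedAddCommGroup E] [InnerProductSpace ℝ E] [FiniteDimensional ℝ E]
    {T : ι → E →ₗ[ℝ] E} (hT : ∀ i, (T i).IsSymmetric)
    (hC : Pairwise (Function.onFun Commute T)) (c : E) :
    ∃ x : Fin (Module.finrank ℝ E) → ι → ℝ, ∀ i j k l,
      inner ℝ (T i (T j c)) (T k (T l c)) = ∑ t, x t i * x t j * x t k * x t l := by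
  classical
  have hmem : c ∈ ⨆ χ : ι → ℝ, ⨅ i, eigenspace (T i) (χ i) := by
    rw [LinearMap.IsSymmetric.iSup_iInf_eq_top_of_commute hT hC]
    trivial
  have horth := LinearMap.IsSymmetric.orthogonalFamily_iInf_eigenspaces hT
  rw [Submodule.mem_iSup_iff_exists_finsupp] at hmem
  obtain ⟨f, hf, rfl⟩ := hmem
  have happly : ∀ χ i, T i (f χ) = χ i • f χ := fun χ i =>
    mem_eigenspace_iff.1 ((Submodule.mem_iInf _).1 (hf χ) i)
  have hne : ∀ χ : f.support, f χ ≠ 0 := fun χ => Finsupp.mem_support_iff.1 χ.2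
  have hinner : ∀ χ ψ, χ ≠ ψ → inner ℝ (f χ) (f ψ) = 0 := fun χ ψ h =>
    horth h ⟨f χ, hf χ⟩ ⟨f ψ, hf ψ⟩
  have hli : LinearIndependent ℝ (fun χ : f.support => f χ) :=
    linearIndependent_of_ne_zero_of_inner_eq_zero hne
      fun χ ψ h => hinner χ ψ fun h' => h (Subtype.ext h')
  have hcard : Fintype.card f.support ≤ Fintype.card (Fin (Module.finrank ℝ E)) := by
    simpa using hli.fintype_card_le_finrank
  obtain ⟨e⟩ := Function.Embedding.nonempty_of_card_le hcard
  let y : f.support → ι → ℝ := fun χ i => √‖f χ‖ * χ.1 i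
  refine ⟨Function.extend e y 0, fun i j k l => ?_⟩
  have hT2 : ∀ i j, T i (T j (f.sum fun _ v => v)) = ∑ χ ∈ f.support, (χ i * χ j) • f χ := by
    intro i j
    simp only [Finsupp.sum, map_sum, happly, map_smul, smul_smul]
    exact Finset.sum_congr rfl fun _ _ => by rw [mul_comm]
  rw [hT2, hT2, sum_inner]
  have hR : ∑ t, Function.extend e y 0 t i * Function.extend e y 0 t j *
      Function.extend e y 0 t k * Function.extend e y 0 t l =
      ∑ χ, y χ i * y χ j * y χ k * y χ l := by
    symm
    refine Finset.sum_of_injOn e e.injective.injOn (by simp) ?_ ?_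
    · intro t _ ht
      have : ¬ ∃ χ, e χ = t := by simpa using ht
      simp [Function.extend_apply' _ _ _ this]
    · intro χ _
      simp [e.injective.extend_apply]
  rw [hR, ← Finset.sum_coe_sort]
  refine Finset.sum_congr rfl fun χ _ => ?_
  rw [inner_sum, Finset.sum_eq_single χ.1]
  · simp only [real_inner_smul_left, real_inner_smul_right, real_inner_self_eq_norm_sq, y]
    have := Real.mul_self_sqrt (norm_nonneg (f χ))
    linear_combination (-χ.1 i * χ.1 j * χ.1 k * χ.1 l * (√‖f χ‖ * √‖f χ‖ + ‖f χ‖)) * this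
  · intro ψ _ h
    rw [real_inner_smul_left, real_inner_smul_right, hinner _ _ h.symm]
    simp
  · intro h
    exact absurd χ.2 h

/-- Matrix form of `LinearMap.IsSymmetric.exists_inner_eq_sum_of_pairwise_commute`. -/
theorem Matrix.exists_dotProduct_eq_sum_of_pairwise_commute {ι n : Type*} [Fintype n]
    [DecidableEq n] {Y : ι → Matrix n n ℝ} (hY : ∀ i, (Y i).IsSymm)
    (hC : ∀ i j, Y i * Y j = Y j * Y i) (c : n → ℝ) :
    ∃ x : Fin (Fintype.card n) → ι → ℝ, ∀ i j k l,
      (Y i *ᵥ (Y j *ᵥ c)) ⬝ᵥ (Y k *ᵥ (Y l *ᵥ c)) = ∑ t, x t i * x t j * x t k * x t l := by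
  have hT : ∀ i, (Matrix.toEuclideanLin (Y i)).IsSymmetric := fun i => by
    rw [Matrix.isSymmetric_toEuclideanLin_iff]
    exact (conjTranspose_eq_transpose_of_trivial (Y i)).trans (hY i)
  have hcomm : Pairwise (Function.onFun Commute fun i => Matrix.toEuclideanLin (Y i)) := by
    intro i j _
    refine LinearMap.ext fun v => ?_
    simp [Matrix.toLpLin_apply, Matrix.mulVec_mulVec, hC i j]
  have key := LinearMap.IsSymmetric.exists_inner_eq_sum_of_pairwise_commute hT hcomm
    (WithLp.toLp 2 c)
  rw [finrank_euclideanSpace] at key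
  obtain ⟨x, hx⟩ := key
  refine ⟨x, fun i j k l => ?_⟩
  rw [← hx, real_inner_comm]
  simp [Matrix.toLpLin_apply, EuclideanSpace.inner_eq_star_dotProduct]

theorem diagonal_mul_diagonal_eq_of_mul_eq_zero {n : Type*} [DecidableEq n]
    {μ : n → ℝ} (h0 : ∀ i j, i ≠ j → μ i * μ j = 0) (i j k l : n) :
    diagonal μ i j * diagonal μ k l = √|μ i| * √|μ j| * √|μ k| * √|μ l| := by
  have h : ∀ i j, i ≠ j → √|μ i| * √|μ j| = 0 := fun i j hij => by
    rw [← Real.sqrt_mul (abs_nonneg _), ← abs_mul, h0 i j hij, abs_zero, Real.sqrt_zero]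
  by_cases hij : i = j
  · subst hij
    by_cases hkl : k = l
    · subst hkl
      rw [diagonal_apply_eq, diagonal_apply_eq, mul_assoc, Real.mul_self_sqrt (abs_nonneg _),
        Real.mul_self_sqrt (abs_nonneg _)]
      by_cases hik : i = k
      · rw [hik, abs_mul_abs_self]
      · rw [← abs_mul, h0 i k hik, abs_zero]
    · rw [diagonal_apply_ne _ hkl, mul_zero, mul_assoc, h k l hkl, mul_zero]
  · rw [diagonal_apply_ne _ hij, zero_mul, h i j hij, zero_mul, zero_mul]

theorem cubic_mul_apply {n : Type*} [Fintype n] {X : n → Matrix n n ℝ}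
    (hs : ∀ i j k, X i j k = X j i k) (hs' : ∀ i j k, X i j k = X i k j) (i j k l : n) :
    (X i * X j) k l = ∑ p, X k i p * X j l p := by
  rw [mul_apply]
  exact Finset.sum_congr rfl fun p _ => by rw [hs i k p, hs' j p l]

section CubicForm

variable {n : Type*} [Fintype n] [DecidableEq n] {X : n → Matrix n n ℝ} {μ : n → ℝ}

/-- The Jacobi identity for the slices of a symmetric three-tensor `X` that becomes the completely
symmetric square of a Gram matrix after adding one diagonal direction `μ`. -/
theorem jacobi_of_cubic (hs : ∀ i j k, X i j k = X j i k) (hs' : ∀ i j k, X i j k = X i k j)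
    (hR : ∀ i j k l, ∑ p, X i j p * X k l p + diagonal μ i j * diagonal μ k l =
      ∑ p, X i k p * X j l p + diagonal μ i k * diagonal μ j l) (a b c p q : n) :
    (μ a - μ b) * μ c * (X a b p * (if q = c then 1 else 0) + X a b q * (if p = c then 1 else 0)) +
    (μ b - μ c) * μ a * (X b c p * (if q = a then 1 else 0) + X b c q * (if p = a then 1 else 0)) +
    (μ c - μ a) * μ b *
      (X c a p * (if q = b then 1 else 0) + X c a q * (if p = b then 1 else 0)) = 0 := by
  have hC : ∀ a b, X a * X b - X b * X a =
      vecMulVec (Pi.single b (μ b)) (Pi.single a (μ a)) -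
      vecMulVec (Pi.single a (μ a)) (Pi.single b (μ b)) := by
    intro a b
    ext p q
    have h := hR p a b q
    have e1 : ∑ r, X p a r * X b q r = (X a * X b) p q := by
      rw [mul_apply]
      exact Finset.sum_congr rfl fun r _ => by rw [hs p a, hs' b q]
    have e2 : ∑ r, X p b r * X a q r = (X b * X a) p q := by
      rw [mul_apply]
      exact Finset.sum_congr rfl fun r _ => by rw [hs p b, hs' a q]
    rw [e1, e2] at h
    simp only [Matrix.sub_apply, vecMulVec_apply, Pi.single_apply]
    simp only [diagonal_apply] at h
    grind
  have hJ : (X a * (X b * X c - X c * X b) - (X b * X c - X c * X b) * X a) +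
      (X b * (X c * X a - X a * X c) - (X c * X a - X a * X c) * X b) +
      (X c * (X a * X b - X b * X a) - (X a * X b - X b * X a) * X c) = 0 := by
    noncomm_ring
  rw [hC, hC, hC] at hJ
  have hsingle : ∀ (i j : n) (x : ℝ),
      Pi.single (M := fun _ => ℝ) i x j = x * if j = i then 1 else 0 :=
    fun i j x => by simp [Pi.single_apply]
  have h := congrFun (congrFun hJ p) q
  simp only [mul_sub, sub_mul, mul_vecMulVec, vecMulVec_mul, Matrix.add_apply, Matrix.sub_apply,
    vecMulVec_apply, mulVec_single, single_vecMul, hsingle, Pi.smul_apply, Matrix.zero_apply,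
    col_apply, row_apply, MulOpposite.smul_eq_mul_unop, MulOpposite.unop_op, smul_eq_mul] at h
  rw [hs' a p c, hs' a p b, hs' b p a, hs' b p c, hs' c p b, hs' c p a, hs a c, hs b a, hs c b,
    hs a c, hs b a, hs c b] at h
  linear_combination h

/-- If `μ` has at least two nonzero entries, the slices of `X` admit a commuting bordered extension
with corner entries `z`. -/
theorem exists_corner_of_cubic (hs : ∀ i j k, X i j k = X j i k)
    (hs' : ∀ i j k, X i j k = X i k j)
    (hR : ∀ i j k l, ∑ p, X i j p * X k l p + diagonal μ i j * diagonal μ k l =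
      ∑ p, X i k p * X j l p + diagonal μ i k * diagonal μ j l)
    {s t : n} (hst : s ≠ t) (hμs : μ s ≠ 0) (hμt : μ t ≠ 0) :
    ∃ z : n → ℝ, ∀ i j k, (μ j - μ i) * X i j k = z i * diagonal μ j k - z j * diagonal μ i k := by
  have hJ := jacobi_of_cubic hs hs' hR
  have hother : ∀ i, ∃ j, j ≠ i ∧ μ j ≠ 0 := fun i => by
    by_cases h : i = s
    · exact ⟨t, h ▸ hst.symm, hμt⟩
    · exact ⟨s, fun h' => h h'.symm, hμs⟩
  have hoff : ∀ a b c p, a ≠ b → a ≠ c → b ≠ c → p ≠ a → p ≠ b →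
      (μ a - μ b) * μ c * X a b p = 0 := by
    intro a b c p hab hac hbc hpa hpb
    have h := hJ a b c p c
    simp only [hpa, hpb, hac.symm, hbc.symm, if_true, if_false] at h
    by_cases hpc : p = c
    · subst hpc
      simp only [if_true] at h
      linear_combination h / 2
    · simp only [hpc, if_false] at h
      linear_combination h
  have hdiag : ∀ a b c, a ≠ b → a ≠ c → b ≠ c →
      (μ c - μ a) * μ b * X c a a = (μ c - μ b) * μ a * X c b b := by
    intro a b c hab hac hbc
    have h := hJ a b c a b
    simp only [hab, hab.symm, hac, hbc, if_true, if_false] at h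
    rw [hs b c b] at h
    linear_combination h
  choose f hf hμf using hother
  have hz : ∀ i j, i ≠ j →
      (μ j - μ i) * X i j j = (1 - μ i / μ (f i)) * X i (f i) (f i) * μ j := by
    intro i j hij
    have hfi := hμf i
    by_cases hj : f i = j
    · subst hj
      field_simp
    · have h := hdiag (f i) j i hj (hf i) hij.symm
      field_simp
      linear_combination h
  have hzero : ∀ i j k, i ≠ j → k ≠ i → k ≠ j → (μ j - μ i) * X i j k = 0 := by
    intro i j k hij hki hkj
    by_cases h : ∃ c, c ≠ i ∧ c ≠ j ∧ μ c ≠ 0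
    · obtain ⟨c, hci, hcj, hc⟩ := h
      have h := hoff i j c k hij hci.symm hcj.symm hki hkj
      have h' : μ c * ((μ j - μ i) * X i j k) = 0 := by linear_combination -h
      exact (mul_eq_zero.1 h').resolve_left hc
    · push Not at h
      have hk := h k hki hkj
      have h1 : μ i ≠ 0 := fun h0 => hμf j (by
        by_cases hfj : f j = i
        · rw [hfj, h0]
        · exact h _ hfj (hf j))
      have h2 : μ j ≠ 0 := fun h0 => hμf i (by
        by_cases hfi : f i = j
        · rw [hfi, h0]
        · exact h _ (hf i) hfi)
      have h3 := hoff i k j j hki.symm hij hkj hij.symm hkj.symm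
      rw [hk, sub_zero, hs' i k j] at h3
      have h4 : X i j k = 0 := (mul_eq_zero.1 h3).resolve_left (mul_ne_zero h1 h2)
      rw [h4, mul_zero]
  refine ⟨fun i => (1 - μ i / μ (f i)) * X i (f i) (f i), fun i j k => ?_⟩
  by_cases hij : i = j
  · subst hij
    ring
  by_cases hkj : k = j
  · subst hkj
    rw [hz i k hij, diagonal_apply_eq, diagonal_apply_ne _ hij]
    ring
  by_cases hki : k = i
  · subst hki
    rw [diagonal_apply_eq, diagonal_apply_ne _ (Ne.symm hij), hs' k j k, hs k k j, hs' k k j,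
      hs k j k]
    have := hz j k (Ne.symm hij)
    linear_combination -this
  · rw [hzero i j k hij hki hkj, diagonal_apply_ne _ (Ne.symm hkj),
      diagonal_apply_ne _ (Ne.symm hki)]
    ring

theorem cubic_mulVec_unit (hs : ∀ i j k, X i j k = X j i k) (hs' : ∀ i j k, X i j k = X i k j)
    {c : n → ℝ} (hc : ∀ j k, ∑ i, c i * X i j k = (1 : Matrix n n ℝ) j k) (i : n) :
    X i *ᵥ c = Pi.single i 1 := by
  ext k
  rw [mulVec, dotProduct, Pi.single_apply, ← Matrix.one_apply, ← hc]
  exact Finset.sum_congr rfl fun j _ => by rw [hs' i k j, hs i j k, hs' j i k, mul_comm]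

theorem exists_sum_of_cubic_of_corner (hs : ∀ i j k, X i j k = X j i k)
    (hs' : ∀ i j k, X i j k = X i k j)
    (hR : ∀ i j k l, ∑ p, X i j p * X k l p + diagonal μ i j * diagonal μ k l =
      ∑ p, X i k p * X j l p + diagonal μ i k * diagonal μ j l)
    {c : n → ℝ} (hc : ∀ j k, ∑ i, c i * X i j k = (1 : Matrix n n ℝ) j k)
    (hcμ : ∀ i, c i * μ i = 0) {z : n → ℝ}
    (hz : ∀ i j k, (μ j - μ i) * X i j k = z i * diagonal μ j k - z j * diagonal μ i k) :
    ∃ x : Fin (Fintype.card n + 1) → n → ℝ, ∀ i j k l,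
      ∑ p, X i j p * X k l p + diagonal μ i j * diagonal μ k l =
        ∑ t, x t i * x t j * x t k * x t l := by
  have hsymm : ∀ i, (X i).IsSymm := fun i => Matrix.ext fun j k => hs' i k j
  have hXc := cubic_mulVec_unit hs hs' hc
  have hmul := cubic_mul_apply hs hs'
  have diagonal_comm : ∀ i j, diagonal μ i j = diagonal μ j i := fun i j =>
    congrFun (congrFun (diagonal_transpose μ) j) i
  let Y : n → Matrix (n ⊕ Unit) (n ⊕ Unit) ℝ := fun i =>
    fromBlocks (X i) (replicateCol Unit (diagonal μ i)) (replicateRow Unit (diagonal μ i))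
      (of fun _ _ => z i)
  have hYs : ∀ i, (Y i).IsSymm := fun i =>
    (hsymm i).fromBlocks rfl rfl
  have hYc : ∀ i, Y i *ᵥ Sum.elim c 0 = Sum.elim (Pi.single i 1) 0 := by
    intro i
    rw [fromBlocks_mulVec]
    congr 1
    · rw [← hXc]
      simp
    · ext
      simpa [mulVec, dotProduct, diagonal_apply, mul_comm] using hcμ i
  have hYY : ∀ i j, Y i *ᵥ (Y j *ᵥ Sum.elim c 0) =
      Sum.elim (X i j) (fun _ => diagonal μ i j) := by
    intro i j
    rw [hYc, fromBlocks_mulVec, Sum.elim_comp_inl, Sum.elim_comp_inr]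
    congr 1
    · ext k
      simp [hs' i j k]
    · ext
      simp
  have hcomm : ∀ i j, Y i * Y j = Y j * Y i := by
    intro i j
    have hdiag : ∀ i j k, (X i *ᵥ diagonal μ j) k = X i j k * μ j := fun i j k => by
      simp [mulVec, dotProduct, diagonal_apply, hs' i k j]
    have hoff : ∀ i j, X i *ᵥ diagonal μ j + z j • diagonal μ i =
        X j *ᵥ diagonal μ i + z i • diagonal μ j := by
      intro i j
      ext k
      have := hz i j k
      simp only [Pi.add_apply, Pi.smul_apply, smul_eq_mul]
      rw [hdiag, hdiag, hs j i k]
      linear_combination this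
    simp only [Y, fromBlocks_multiply]
    congr 1
    · ext k l
      rw [Matrix.add_apply, Matrix.add_apply, hmul, hmul]
      have := hR k i j l
      simp only [mul_apply, replicateCol_apply, replicateRow_apply, Finset.univ_unique,
        Finset.sum_singleton]
      rw [diagonal_comm i k, diagonal_comm j k]
      linear_combination this
    · ext k _
      have := congrFun (hoff i j) k
      simp only [Pi.add_apply, Pi.smul_apply, smul_eq_mul, mulVec, dotProduct] at this
      simp only [Matrix.add_apply, mul_apply, replicateCol_apply, of_apply, Finset.univ_unique,
        Finset.sum_singleton]
      linear_combination this
    · ext _ k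
      have := congrFun (hoff i j) k
      simp only [Pi.add_apply, Pi.smul_apply, smul_eq_mul] at this
      rw [← (hsymm i).eq, ← (hsymm j).eq, mulVec_transpose, mulVec_transpose] at this
      simp only [vecMul, dotProduct] at this
      simp only [Matrix.add_apply, mul_apply, replicateRow_apply, of_apply, Finset.univ_unique,
        Finset.sum_singleton]
      linear_combination -this
    · ext
      simp [mul_apply, mul_comm]
  have key := exists_dotProduct_eq_sum_of_pairwise_commute hYs hcomm (Sum.elim c 0)
  rw [Fintype.card_sum, Fintype.card_unit] at key
  obtain ⟨x, hx⟩ := key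
  refine ⟨x, fun i j k l => ?_⟩
  rw [← hx, hYY, hYY]
  simp [dotProduct]

theorem exists_sum_of_cubic_of_mul_eq_zero (hs : ∀ i j k, X i j k = X j i k)
    (hs' : ∀ i j k, X i j k = X i k j)
    (hR : ∀ i j k l, ∑ p, X i j p * X k l p + diagonal μ i j * diagonal μ k l =
      ∑ p, X i k p * X j l p + diagonal μ i k * diagonal μ j l)
    {c : n → ℝ} (hc : ∀ j k, ∑ i, c i * X i j k = (1 : Matrix n n ℝ) j k)
    (h0 : ∀ i j, i ≠ j → μ i * μ j = 0) :
    ∃ x : Fin (Fintype.card n + 1) → n → ℝ, ∀ i j k l,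
      ∑ p, X i j p * X k l p + diagonal μ i j * diagonal μ k l =
        ∑ t, x t i * x t j * x t k * x t l := by
  have hsymm : ∀ i, (X i).IsSymm := fun i => Matrix.ext fun j k => hs' i k j
  have hXc := cubic_mulVec_unit hs hs' hc
  have hmul := cubic_mul_apply hs hs'
  have hcomm : ∀ i j, X i * X j = X j * X i := by
    intro i j
    ext k l
    rw [hmul, hmul]
    have := hR k i j l
    have h1 : diagonal μ k i * diagonal μ j l = diagonal μ k j * diagonal μ i l := by
      rw [diagonal_mul_diagonal_eq_of_mul_eq_zero h0, diagonal_mul_diagonal_eq_of_mul_eq_zero h0]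
      ring
    rw [h1] at this
    exact add_right_cancel this
  obtain ⟨x, hx⟩ := exists_dotProduct_eq_sum_of_pairwise_commute hsymm hcomm c
  refine ⟨Fin.snoc x fun i => √|μ i|, fun i j k l => ?_⟩
  rw [Fin.sum_univ_castSucc]
  simp only [Fin.snoc_castSucc, Fin.snoc_last]
  rw [← hx, hXc, hXc]
  congr 1
  · simp [dotProduct, hs' _ j, hs' _ l]
  · exact diagonal_mul_diagonal_eq_of_mul_eq_zero h0 i j k l

theorem exists_sum_of_cubic (hs : ∀ i j k, X i j k = X j i k)
    (hs' : ∀ i j k, X i j k = X i k j)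
    (hR : ∀ i j k l, ∑ p, X i j p * X k l p + diagonal μ i j * diagonal μ k l =
      ∑ p, X i k p * X j l p + diagonal μ i k * diagonal μ j l)
    {c : n → ℝ} (hc : ∀ j k, ∑ i, c i * X i j k = (1 : Matrix n n ℝ) j k)
    (hcμ : ∀ i, c i * μ i = 0) :
    ∃ x : Fin (Fintype.card n + 1) → n → ℝ, ∀ i j k l,
      ∑ p, X i j p * X k l p + diagonal μ i j * diagonal μ k l =
        ∑ t, x t i * x t j * x t k * x t l := by
  by_cases h : ∃ s t, s ≠ t ∧ μ s ≠ 0 ∧ μ t ≠ 0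
  · obtain ⟨s, t, hst, hμs, hμt⟩ := h
    obtain ⟨z, hz⟩ := exists_corner_of_cubic hs hs' hR hst hμs hμt
    exact exists_sum_of_cubic_of_corner hs hs' hR hc hcμ hz
  · refine exists_sum_of_cubic_of_mul_eq_zero hs hs' hR hc fun i j hij => ?_
    by_contra h'
    exact h ⟨i, j, hij, left_ne_zero_of_mul h', right_ne_zero_of_mul h'⟩

end CubicForm

/-- A symmetric bilinear form on a Euclidean space is diagonal in some orthonormal basis. -/
theorem exists_orthonormalBasis_diagonal_s14 {F : Type*} [NormedAddCommGroup F] [InnerProductSpace ℝ F]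
    [FiniteDimensional ℝ F] {n : ℕ} (hn : Module.finrank ℝ F = n) (B : F →ₗ[ℝ] F →ₗ[ℝ] ℝ)
    (hB : ∀ x y, B x y = B y x) :
    ∃ (g : OrthonormalBasis (Fin n) ℝ F) (μ : Fin n → ℝ), ∀ i j,
      B (g i) (g j) = diagonal μ i j := by
  let e := stdOrthonormalBasis ℝ F
  let S : F →ₗ[ℝ] F := ∑ i, (B.flip (e i)).smulRight (e i)
  have hSB : ∀ x y, inner ℝ (S x) y = B x y := by
    intro x y
    conv_rhs => rw [← e.sum_repr' y]
    simp [S, sum_inner, real_inner_smul_left, mul_comm]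
  have hS : S.IsSymmetric := fun x y => by
    rw [hSB, real_inner_comm, hSB, hB]
  refine ⟨hS.eigenvectorBasis hn, hS.eigenvalues hn, fun i j => ?_⟩
  rw [← hSB, hS.apply_eigenvectorBasis, real_inner_smul_left, OrthonormalBasis.inner_eq_ite,
    diagonal_apply]
  simp

section GramMap

variable {W E : Type*} [AddCommGroup W] [Module ℝ W] [FiniteDimensional ℝ W]
  [NormedAddCommGroup E] [InnerProductSpace ℝ E] {β : W →ₗ[ℝ] W →ₗ[ℝ] E}

/-- If `β l` has maximal rank, then `β m` maps its kernel into its range. -/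
theorem apply_mem_range_of_finrank_range_le {l m a : W}
    (hl : ∀ l', Module.finrank ℝ (LinearMap.range (β l')) ≤
      Module.finrank ℝ (LinearMap.range (β l)))
    (ha : β l a = 0) : β m a ∈ LinearMap.range (β l) := by
  by_contra hnot
  let e := Module.finBasis ℝ (LinearMap.range (β l))
  choose b hb using fun i => (e i).2
  let v : ℝ → Fin (Module.finrank ℝ (LinearMap.range (β l)) + 1) → E := fun t =>
    Fin.cons (β m a) fun i => β (l + t • m) (b i)
  have hbe : (fun i => β l (b i)) = (LinearMap.range (β l)).subtype ∘ e := funext hb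
  have hspan := congrArg (Submodule.map (LinearMap.range (β l)).subtype) e.span_eq
  rw [Submodule.map_span, Submodule.map_top, Submodule.range_subtype, ← Set.range_comp] at hspan
  have hv0 : LinearIndependent ℝ (v 0) := by
    simp only [v, zero_smul, add_zero]
    rw [linearIndependent_finCons, hbe, hspan]
    exact ⟨e.linearIndependent.map' (LinearMap.range (β l)).subtype (Submodule.ker_subtype _), hnot⟩
  have hcont : Continuous v := by
    refine continuous_pi fun i => ?_
    refine Fin.cases ?_ (fun i => ?_) i
    · exact continuous_const
    · simp only [v, Fin.cons_succ, map_add, map_smul, LinearMap.add_apply, LinearMap.smul_apply]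
      fun_prop
  have hev : ∀ᶠ t in nhds (0 : ℝ), LinearIndependent ℝ (v t) :=
    hcont.continuousAt.eventually (isOpen_setOfPred_linearIndependent.mem_nhds hv0)
  obtain ⟨t, ht, ht0⟩ : ∃ t, LinearIndependent ℝ (v t) ∧ t ≠ 0 :=
    ((hev.filter_mono nhdsWithin_le_nhds).and
      (self_mem_nhdsWithin : {(0 : ℝ)}ᶜ ∈ nhdsWithin 0 {(0 : ℝ)}ᶜ)).exists
  have hmem : ∀ i, v t i ∈ LinearMap.range (β (l + t • m)) := by
    intro i
    refine Fin.cases ?_ (fun i => ?_) i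
    · refine ⟨t⁻¹ • a, ?_⟩
      simp [v, ha, ht0]
    · exact ⟨b i, by simp [v]⟩
  have hli : LinearIndependent ℝ (fun i => (⟨v t i, hmem i⟩ : LinearMap.range (β (l + t • m)))) :=
    LinearIndependent.of_comp (LinearMap.range (β (l + t • m))).subtype ht
  have := hli.fintype_card_le_finrank
  have := hl (l + t • m)
  simp at *
  omega

/-- A nondegenerate Gram map with symmetric inner products has an injective slice. -/
theorem exists_injective_of_exchange (hsymm : ∀ a b, β a b = β b a)
    (hex : ∀ a b c d, inner ℝ (β a b) (β c d) = inner ℝ (β a c) (β b d))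
    (hnd : ∀ a, (∀ m, β a m = 0) → a = 0) : ∃ l, Function.Injective (β l) := by
  let l := Function.argmin fun l => Module.finrank ℝ (LinearMap.ker (β l))
  have hl : ∀ l', Module.finrank ℝ (LinearMap.range (β l')) ≤
      Module.finrank ℝ (LinearMap.range (β l)) := by
    intro l'
    have h1 := (β l).finrank_range_add_finrank_ker
    have h2 := (β l').finrank_range_add_finrank_ker
    have h3 : Module.finrank ℝ (LinearMap.ker (β l)) ≤ Module.finrank ℝ (LinearMap.ker (β l')) :=
      Function.argmin_le (fun l => Module.finrank ℝ (LinearMap.ker (β l))) l'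
    omega
  refine ⟨l, (injective_iff_map_eq_zero _).2 fun a ha => hnd a fun m => ?_⟩
  obtain ⟨b, hb⟩ := apply_mem_range_of_finrank_range_le (m := m) hl ha
  rw [← inner_self_eq_zero (𝕜 := ℝ)]
  calc inner ℝ (β a m) (β a m) = inner ℝ (β a m) (β l b) := by rw [hb, hsymm m a]
    _ = 0 := by rw [hex, hsymm a l, ha, inner_zero_left]

/-- A Gram map of codimension one with completely symmetric inner products gives a quartic form
which is a sum of `finrank E` fourth powers of linear forms. -/
theorem exists_sum_fourth_powers_of_exchange [FiniteDimensional ℝ E] {n : ℕ}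
    (hsymm : ∀ a b, β a b = β b a)
    (hex : ∀ a b c d, inner ℝ (β a b) (β c d) = inner ℝ (β a c) (β b d))
    (hnd : ∀ a, (∀ m, β a m = 0) → a = 0)
    (hW : Module.finrank ℝ W = n) (hE : Module.finrank ℝ E = n + 1) :
    ∃ y : Fin (n + 1) → W →ₗ[ℝ] ℝ, ∀ a b c d,
      inner ℝ (β a b) (β c d) = ∑ t, y t a * y t b * y t c * y t d := by
  obtain ⟨l, hl⟩ := exists_injective_of_exchange hsymm hex hnd
  let F := LinearMap.range (β l)
  let J : W ≃ₗ[ℝ] F := LinearEquiv.ofInjective (β l) hl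
  have hF : Module.finrank ℝ F = n := by rw [← hW, J.finrank_eq]
  have hF' : Module.finrank ℝ Fᗮ = 1 := by
    have := F.finrank_add_finrank_orthogonal
    omega
  let u := (stdOrthonormalBasis ℝ Fᗮ).reindex (finCongr hF')
  let w : E := u 0
  have hw : ‖w‖ = 1 := u.norm_eq_one 0
  have hFw : ∀ x : F, inner ℝ (x : E) w = 0 := fun x => (u 0).2 x x.2
  obtain ⟨g, μ, hg⟩ := exists_orthonormalBasis_diagonal_s14 hF
    ((β.compl₁₂ J.symm.toLinearMap J.symm.toLinearMap).compr₂ (innerₛₗ ℝ w))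
    (fun x y => by simp [hsymm (J.symm x)])
  let f : Module.Basis (Fin n) ℝ W := g.toBasis.map J.symm
  have hβf : ∀ i, β l (f i) = g i := fun i => by
    have : (J (f i) : E) = g i := by simp [f]
    exact this
  have hμ : ∀ i j, inner ℝ (β (f i) (f j)) w = diagonal μ i j := fun i j => by
    rw [← hg, real_inner_comm]
    simp [f]
  have hv : Orthonormal ℝ (Sum.elim (fun i => (g i : E)) fun _ : Unit => w) := by
    rw [orthonormal_iff_ite]
    have h := orthonormal_iff_ite.1 g.orthonormal
    simp only [Submodule.coe_inner] at h
    rintro (i | i) (j | j)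
    · simp [h]
    · simp [hFw]
    · simp [real_inner_comm _ w, hFw]
    · simp [hw]
  let o := OrthonormalBasis.mk hv (hv.linearIndependent.span_eq_top_of_card_eq_finrank'
    (by simp [hE])).ge
  have hinner : ∀ i j k l, inner ℝ (β (f i) (f j)) (β (f k) (f l)) =
      ∑ p, inner ℝ (β (f i) (f j)) (g p : E) * inner ℝ (β (f k) (f l)) (g p : E) +
        diagonal μ i j * diagonal μ k l := by
    intro i j k l
    rw [← o.sum_inner_mul_inner, Fintype.sum_sum_type, ← hμ i j, ← hμ k l]
    simp [o, real_inner_comm]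
  let X : Fin n → Matrix (Fin n) (Fin n) ℝ := fun i =>
    of fun j k => inner ℝ (β (f i) (f j)) (g k : E)
  have hs : ∀ i j k, X i j k = X j i k := fun i j k => by simp only [X, of_apply, hsymm]
  have hs' : ∀ i j k, X i j k = X i k j := fun i j k => by
    simp only [X, of_apply, ← hβf, hsymm l]
    exact hex _ _ _ _
  have hR : ∀ i j k l, ∑ p, X i j p * X k l p + diagonal μ i j * diagonal μ k l =
      ∑ p, X i k p * X j l p + diagonal μ i k * diagonal μ j l := fun i j k l => by
    simp only [X, of_apply]
    rw [← hinner, ← hinner, hex]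
  have hrepr : ∀ (a : W) (v : E), ∑ i, f.repr l i * inner ℝ (β (f i) a) v = inner ℝ (β l a) v := by
    intro a v
    have h := congrArg (fun m => inner ℝ (β m a) v) (f.sum_repr l)
    simpa only [map_sum, map_smul, LinearMap.sum_apply, LinearMap.smul_apply, sum_inner,
      real_inner_smul_left] using h
  have hc : ∀ j k, ∑ i, f.repr l i * X i j k = (1 : Matrix (Fin n) (Fin n) ℝ) j k := by
    intro j k
    simp only [X, of_apply]
    rw [hrepr, hβf, ← Submodule.coe_inner, g.inner_eq_ite, one_apply]
  have hcμ : ∀ j, f.repr l j * μ j = 0 := by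
    intro j
    have h := hrepr (f j) w
    rw [hβf, hFw] at h
    simpa [hμ, diagonal_apply] using h
  have key := exists_sum_of_cubic hs hs' hR hc hcμ
  rw [Fintype.card_fin] at key
  obtain ⟨x, hx⟩ := key
  let y : Fin (n + 1) → W →ₗ[ℝ] ℝ := fun t => f.constr ℝ (x t)
  let P : W → W → W → W → Prop := fun a b c d =>
    inner ℝ (β a b) (β c d) = ∑ t, y t a * y t b * y t c * y t d
  have swap : ∀ {a b c d}, P a b c d → P b a c d := fun {a b c d} h => by
    simp only [P, hsymm b a] at h ⊢
    rw [h]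
    exact Finset.sum_congr rfl fun t _ => by ring
  have swap' : ∀ {a b c d}, P a b c d → P c d a b := fun {a b c d} h => by
    simp only [P, real_inner_comm (β a b)] at h ⊢
    rw [h]
    exact Finset.sum_congr rfl fun t _ => by ring
  have extend : ∀ {b c d}, (∀ i, P (f i) b c d) → ∀ a, P a b c d := fun {b c d} h a => by
    have : innerₛₗ ℝ (β c d) ∘ₗ β.flip b = ∑ t, (y t b * y t c * y t d) • y t := by
      refine f.ext fun i => ?_
      have := h i
      simp only [P] at this
      simp only [LinearMap.comp_apply, LinearMap.flip_apply, innerₛₗ_apply_apply,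
        LinearMap.sum_apply, LinearMap.smul_apply, smul_eq_mul]
      rw [real_inner_comm, this]
      exact Finset.sum_congr rfl fun t _ => by ring
    have := LinearMap.congr_fun this a
    simp only [LinearMap.comp_apply, LinearMap.flip_apply, innerₛₗ_apply_apply,
      LinearMap.sum_apply, LinearMap.smul_apply, smul_eq_mul] at this
    simp only [P]
    rw [real_inner_comm, this]
    exact Finset.sum_congr rfl fun t _ => by ring
  have h0 : ∀ i j k l, P (f i) (f j) (f k) (f l) := fun i j k l => by
    simp only [P, y, f.constr_basis]
    rw [hinner]
    exact hx i j k l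
  have h1 : ∀ a j k l, P a (f j) (f k) (f l) := fun a j k l => extend (fun i => h0 i j k l) a
  have h2 : ∀ a b k l, P a b (f k) (f l) := fun a b k l =>
    swap (extend (fun j => swap (h1 a j k l)) b)
  have h3 : ∀ a b c l, P a b c (f l) := fun a b c l =>
    swap' (extend (fun k => swap' (h2 a b k l)) c)
  exact ⟨y, fun a b c d => swap' (swap (extend (fun l => swap (swap' (h3 a b c l))) d))⟩

end GramMap

open scoped MatrixOrder in
/-- A positive semidefinite matrix is a Gram matrix of vectors in a space of dimension its rank. -/
theorem Matrix.PosSemidef.exists_gram {p : Type*} [Fintype p] [DecidableEq p] {ρ : Matrix p p ℝ}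
    (hρ : ρ.PosSemidef) :
    ∃ v : p → EuclideanSpace ℝ (Fin ρ.rank), ∀ a b, inner ℝ (v a) (v b) = ρ a b := by
  obtain ⟨B, hB⟩ := CStarAlgebra.nonneg_iff_eq_star_mul_self.mp hρ.nonneg
  let c : p → EuclideanSpace ℝ p := fun j => WithLp.toLp 2 (B.col j)
  let E := Submodule.span ℝ (Set.range c)
  have hE : Module.finrank ℝ E = ρ.rank := by
    have : E = (Submodule.span ℝ (Set.range B.col)).map
        (WithLp.linearEquiv 2 ℝ (p → ℝ)).symm.toLinearMap := by
      rw [Submodule.map_span, ← Set.range_comp]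
      rfl
    rw [this, LinearEquiv.finrank_map_eq, hB, star_eq_conjTranspose,
      rank_conjTranspose_mul_self, rank_eq_finrank_span_cols]
  let e := (stdOrthonormalBasis ℝ E).reindex (finCongr hE)
  refine ⟨fun j => e.repr ⟨c j, Submodule.subset_span ⟨j, rfl⟩⟩, fun a b => ?_⟩
  rw [LinearIsometryEquiv.inner_map_map, Submodule.coe_inner, hB]
  simp [c, PiLp.inner_apply, star_eq_conjTranspose, mul_apply, mul_comm]

theorem CompletelySymmetric.swap_left {N : ℕ} {ρ : Matrix (Fin N × Fin N) (Fin N × Fin N) ℝ}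
    (hρ : CompletelySymmetric ρ) (i j k l : Fin N) : ρ (k, i) (j, l) = ρ (i, k) (j, l) :=
  hρ (Equiv.swap 0 2) ![i, j, k, l]

theorem CompletelySymmetric.swap_middle {N : ℕ} {ρ : Matrix (Fin N × Fin N) (Fin N × Fin N) ℝ}
    (hρ : CompletelySymmetric ρ) (i j k l : Fin N) : ρ (i, j) (k, l) = ρ (i, k) (j, l) :=
  hρ (Equiv.swap 1 2) ![i, j, k, l]

/-- A completely symmetric state supported on `ℝ^N ⊗ ℝ^N` (`N > 3`) of rank `N+1` is
either a sum of `N+1` symmetric pure product terms, or the sum of a rank-4 completely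
symmetric positive semidefinite matrix supported on a `3⊗3` subspace and `N-3` symmetric
pure product terms whose vectors are orthogonal to the column space of `σ₁`. -/
theorem completelySymmetric_rank_succ_decomposition {N : ℕ} (hN : 3 < N)
    (ρ : Matrix (Fin N × Fin N) (Fin N × Fin N) ℝ)
    (hcs : CompletelySymmetric ρ) (hpsd : ρ.PosSemidef) (htr : ρ.trace = 1)
    (hsupp : (reducedMat ρ).rank = N) (hrank : ρ.rank = N + 1) :
    (∃ x : Fin (N + 1) → Fin N → ℝ,
        ρ = ∑ t, vecMulVec (x t) (x t) ⊗ₖ vecMulVec (x t) (x t)) ∨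
    (∃ (σ : Matrix (Fin N × Fin N) (Fin N × Fin N) ℝ) (x : Fin (N - 3) → Fin N → ℝ),
        ρ = σ + ∑ i, vecMulVec (x i) (x i) ⊗ₖ vecMulVec (x i) (x i) ∧
        CompletelySymmetric σ ∧ σ.PosSemidef ∧ σ.rank = 4 ∧
        (reducedMat σ).rank = 3 ∧
        ∀ i, ∀ v ∈ colSpace (reducedMat σ), ∑ j, x i j * v j = 0) := by
  left
  obtain ⟨v, hv⟩ := hpsd.exists_gram
  let β : (Fin N → ℝ) →ₗ[ℝ] (Fin N → ℝ) →ₗ[ℝ] EuclideanSpace ℝ (Fin ρ.rank) :=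
    ∑ i, ∑ k, (LinearMap.proj i).smulRight ((LinearMap.proj k).smulRight (v (i, k)))
  have hβ : ∀ a b, β a b = ∑ i, ∑ k, (a i * b k) • v (i, k) := fun a b => by
    simp [β, smul_smul]
  have hβe : ∀ i k, β (Pi.single i 1) (Pi.single k 1) = v (i, k) := fun i k => by
    rw [hβ, Finset.sum_eq_single i, Finset.sum_eq_single k] <;> simp +contextual
  have hvs : ∀ i k, v (i, k) = v (k, i) := fun i k => by
    rw [← sub_eq_zero, ← inner_self_eq_zero (𝕜 := ℝ)]
    simp only [inner_sub_left, inner_sub_right, hv, hcs.swap_left, sub_self]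
  have hinner : ∀ a b c d, inner ℝ (β a b) (β c d) =
      ∑ i, ∑ k, ∑ j, ∑ l, a i * b k * (c j * d l) * ρ (i, k) (j, l) := fun a b c d => by
    simp only [hβ, sum_inner]
    refine Finset.sum_congr rfl fun i _ => Finset.sum_congr rfl fun k _ => ?_
    simp only [inner_sum]
    refine Finset.sum_congr rfl fun j _ => Finset.sum_congr rfl fun l _ => ?_
    rw [real_inner_smul_left, real_inner_smul_right, hv]
    ring
  have hsymm : ∀ a b, β a b = β b a := fun a b => by
    rw [hβ, hβ, Finset.sum_comm]
    exact Finset.sum_congr rfl fun i _ => Finset.sum_congr rfl fun k _ => by rw [hvs, mul_comm]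
  have hex : ∀ a b c d, inner ℝ (β a b) (β c d) = inner ℝ (β a c) (β b d) := fun a b c d => by
    rw [hinner, hinner]
    refine Finset.sum_congr rfl fun i _ => ?_
    rw [Finset.sum_comm]
    refine Finset.sum_congr rfl fun j _ => Finset.sum_congr rfl fun k _ =>
      Finset.sum_congr rfl fun l _ => ?_
    rw [hcs.swap_middle i j k l]
    ring
  have hnd : ∀ a, (∀ m, β a m = 0) → a = 0 := fun a ha => by
    have hinj : Function.Injective (reducedMat ρ).mulVec := by
      change Function.Injective (reducedMat ρ).mulVecLin
      rw [LinearMap.injective_iff_surjective, ← LinearMap.range_eq_top]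
      exact Submodule.eq_top_of_finrank_eq (hsupp.trans (by simp))
    apply hinj
    rw [mulVec_zero]
    ext i
    have : ∀ k, inner ℝ (v (i, k)) (β a (Pi.single k 1)) = ∑ j, ρ (i, k) (j, k) * a j := fun k => by
      rw [hβ, inner_sum]
      refine Finset.sum_congr rfl fun j _ => ?_
      rw [Finset.sum_eq_single k]
      · rw [Pi.single_eq_same, mul_one, real_inner_smul_right, hv, mul_comm]
      · simp +contextual
      · simp
    simp only [ha, inner_zero_right] at this
    simp only [mulVec, dotProduct, reducedMat, of_apply, Finset.sum_mul, Pi.zero_apply]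
    rw [Finset.sum_comm]
    exact Finset.sum_eq_zero fun k _ => (this k).symm
  obtain ⟨y, hy⟩ := exists_sum_fourth_powers_of_exchange hsymm hex hnd (n := N)
    (by simp) (by simp [hrank])
  refine ⟨fun t i => y t (Pi.single i 1), ?_⟩
  ext ⟨i, k⟩ ⟨j, l⟩
  rw [← hv, ← hβe, ← hβe, hy, Matrix.sum_apply]
  refine Finset.sum_congr rfl fun t _ => ?_
  simp only [kroneckerMap_apply, vecMulVec_apply]
  ring
end

section
/- Let ρ be a completely symmetric state supported on ℝ^N ⊗ ℝ^N that is separable over ℝ. If N ≤ 2 or rank(ρ) ≤ N + 1, then ρ is S-separable. -/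
open Matrix
open Kronecker
open scoped BigOperators

/-- If `x ⊗ y` is a symmetric tensor over `ℝ`, then `(x xᵀ) ⊗ (y yᵀ)` has the form
`(z zᵀ) ⊗ (z zᵀ)`. -/
theorem exists_vecMulVec_kronecker_self_eq {n : Type*} (x y : n → ℝ)
    (hxy : ∀ i j, x i * y j = x j * y i) :
    ∃ z : n → ℝ, vecMulVec x x ⊗ₖ vecMulVec y y = vecMulVec z z ⊗ₖ vecMulVec z z := by
  by_cases hx : x = 0
  · exact ⟨0, by simp [hx]⟩
  obtain ⟨m, hm⟩ := Function.ne_iff.mp hx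
  have hm : x m ≠ 0 := hm
  set c := y m / x m with hc
  have hy : ∀ i, y i = c * x i := fun i => by
    rw [hc]
    field_simp
    linarith [hxy i m]
  have hs : √|c| ^ 4 = c ^ 2 := by
    rw [show √|c| ^ 4 = (√|c| ^ 2) ^ 2 by ring, Real.sq_sqrt (abs_nonneg c), sq_abs]
  refine ⟨fun i => √|c| * x i, ?_⟩
  ext ⟨i, k⟩ ⟨j, l⟩
  simp only [kroneckerMap_apply, vecMulVec_apply, hy]
  linear_combination (-(x i * x j * x k * x l)) * hs

/-- In a separable decomposition of a completely symmetric matrix, every product vector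
`x t ⊗ y t` is a symmetric tensor. -/
theorem CompletelySymmetric.mul_comm_of_eq_sum {N L : ℕ}
    {ρ : Matrix (Fin N × Fin N) (Fin N × Fin N) ℝ} (hcs : CompletelySymmetric ρ)
    {x y : Fin L → Fin N → ℝ}
    (hρ : ρ = ∑ t, vecMulVec (x t) (x t) ⊗ₖ vecMulVec (y t) (y t)) (t : Fin L) (i j : Fin N) :
    x t i * y t j = x t j * y t i := by
  have hswap : ∀ a b, ρ (a, b) (b, a) = ρ (a, b) (a, b) := fun a b => by
    simpa [Equiv.swap_apply_def] using hcs (Equiv.swap 1 3) ![a, a, b, b]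
  have hentry : ∀ a b c d, ρ (a, b) (c, d) = ∑ t, x t a * x t c * (y t b * y t d) := by
    intro a b c d
    simp [hρ, Matrix.sum_apply, vecMulVec_apply]
  have hsum : ∑ t, (x t i * y t j - x t j * y t i) ^ 2 = 0 := by
    calc ∑ t, (x t i * y t j - x t j * y t i) ^ 2
        = ρ (i, j) (i, j) - ρ (i, j) (j, i) + (ρ (j, i) (j, i) - ρ (j, i) (i, j)) := by
          simp only [hentry, ← Finset.sum_sub_distrib, ← Finset.sum_add_distrib]
          exact Finset.sum_congr rfl fun t _ => by ring
      _ = 0 := by rw [hswap, hswap]; ring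
  have ht := (Finset.sum_eq_zero_iff_of_nonneg fun t _ => sq_nonneg _).mp hsum t
    (Finset.mem_univ t)
  exact sub_eq_zero.mp (pow_eq_zero_iff two_ne_zero |>.mp ht)

/-- A separable completely symmetric state supported on `ℝ^N ⊗ ℝ^N` is S-separable
whenever `N ≤ 2` or `rank ρ ≤ N + 1`. -/
theorem completelySymmetric_separable_sSeparable {N : ℕ}
    (ρ : Matrix (Fin N × Fin N) (Fin N × Fin N) ℝ)
    (hcs : CompletelySymmetric ρ) (hpsd : ρ.PosSemidef) (htr : ρ.trace = 1)
    (hsupp : (reducedMat ρ).rank = N) (hsep : SeparableR ρ)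
    (h : N ≤ 2 ∨ ρ.rank ≤ N + 1) :
    SSeparable ρ := by
  obtain ⟨L, x, y, hρ⟩ := hsep
  choose z hz using fun t =>
    exists_vecMulVec_kronecker_self_eq (x t) (y t) (hcs.mul_comm_of_eq_sum hρ t)
  exact ⟨L, z, by simp only [hρ, hz]⟩
end

section
/- Suppose x* is a local maximizer of f restricted to the unit sphere of ℝ^N. Then for every unit vector x ∈ ℝ^N, |f(x*) − f(x)| ≤ 2 ‖η‖₂ ‖x − x*‖². -/
open Matrix
open Kronecker
open scoped BigOperators

/-- The spectral norm (largest singular value) of a real matrix, as the operator norm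
of the induced map between Euclidean spaces. -/
noncomputable def specNorm {m n : Type*} [Fintype m] [Fintype n] [DecidableEq n]
    (M : Matrix m n ℝ) : ℝ :=
  ‖LinearMap.toContinuousLinearMap (Matrix.toEuclideanLin M)‖

/-- The quartic form `f(x) = (1/4) Σ_{i,j,k,l} η_{ijkl} x_i x_j x_k x_l`. -/
noncomputable def fquart {N : ℕ} (η : Matrix (Fin N × Fin N) (Fin N × Fin N) ℝ)
    (x : Fin N → ℝ) : ℝ :=
  (1 / 4) * ∑ i, ∑ j, ∑ k, ∑ l, η (i, k) (j, l) * x i * x j * x k * x l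

/-- The matrix `B_x` with entries `(B_x)_{ij} = Σ_{k,l} η_{ijkl} x_k x_l`;
the Hessian of `fquart η` at `x` is `3 B_x`. -/
def Bmat {N : ℕ} (η : Matrix (Fin N × Fin N) (Fin N × Fin N) ℝ) (x : Fin N → ℝ) :
    Matrix (Fin N) (Fin N) ℝ :=
  Matrix.of fun i j => ∑ k, ∑ l, η (i, k) (j, l) * x k * x l

/-- The quadrilinear form `∑ η_{ijkl} a_i b_j c_k d_l` attached to `η`. -/
def quadForm {N : ℕ} (η : Matrix (Fin N × Fin N) (Fin N × Fin N) ℝ)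
    (a b c d : Fin N → ℝ) : ℝ :=
  ∑ i, ∑ j, ∑ k, ∑ l, η (i, k) (j, l) * a i * b j * c k * d l

section quadForm

variable {N : ℕ} {η : Matrix (Fin N × Fin N) (Fin N × Fin N) ℝ}

lemma fquart_eq_quadForm (x : Fin N → ℝ) : fquart η x = (1 / 4) * quadForm η x x x x := rfl

lemma quadForm_swap_first (hη : CompletelySymmetric η) (a b c d : Fin N → ℝ) :
    quadForm η a b c d = quadForm η b a c d := by
  unfold quadForm
  rw [Finset.sum_comm]
  refine Finset.sum_congr rfl fun j _ => Finset.sum_congr rfl fun i _ =>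
    Finset.sum_congr rfl fun k _ => Finset.sum_congr rfl fun l _ => ?_
  have h : η (j, k) (i, l) = η (i, k) (j, l) := hη (Equiv.swap 0 1) ![i, j, k, l]
  rw [h]
  ring

lemma quadForm_swap_middle (hη : CompletelySymmetric η) (a b c d : Fin N → ℝ) :
    quadForm η a b c d = quadForm η a c b d := by
  unfold quadForm
  refine Finset.sum_congr rfl fun i _ => ?_
  rw [Finset.sum_comm]
  refine Finset.sum_congr rfl fun k _ => Finset.sum_congr rfl fun j _ =>
    Finset.sum_congr rfl fun l _ => ?_
  have h : η (i, j) (k, l) = η (i, k) (j, l) := hη (Equiv.swap 1 2) ![i, j, k, l]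
  rw [h]
  ring

lemma quadForm_swap_last (hη : CompletelySymmetric η) (a b c d : Fin N → ℝ) :
    quadForm η a b c d = quadForm η a b d c := by
  unfold quadForm
  refine Finset.sum_congr rfl fun i _ => Finset.sum_congr rfl fun j _ => ?_
  rw [Finset.sum_comm]
  refine Finset.sum_congr rfl fun l _ => Finset.sum_congr rfl fun k _ => ?_
  have h : η (i, l) (j, k) = η (i, k) (j, l) := hη (Equiv.swap 2 3) ![i, j, k, l]
  rw [h]
  ring

lemma quadForm_add_right (a b c d e : Fin N → ℝ) :
    quadForm η a b c (d + e) = quadForm η a b c d + quadForm η a b c e := by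
  simp only [quadForm, Pi.add_apply, mul_add, Finset.sum_add_distrib]

lemma quadForm_smul (a b c d : Fin N → ℝ) (p q r s : ℝ) :
    quadForm η (p • a) (q • b) (r • c) (s • d) = p * q * r * s * quadForm η a b c d := by
  simp only [quadForm, Pi.smul_apply, smul_eq_mul, Finset.mul_sum]
  refine Finset.sum_congr rfl fun i _ => Finset.sum_congr rfl fun j _ =>
    Finset.sum_congr rfl fun k _ => Finset.sum_congr rfl fun l _ => ?_
  ring

lemma quadForm_add_third (hη : CompletelySymmetric η) (a b c d e : Fin N → ℝ) :
    quadForm η a b (c + e) d = quadForm η a b c d + quadForm η a b e d := by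
  rw [quadForm_swap_last hη, quadForm_add_right, quadForm_swap_last hη a b d,
    quadForm_swap_last hη a b d]

lemma quadForm_add_second (hη : CompletelySymmetric η) (a b c d e : Fin N → ℝ) :
    quadForm η a (b + e) c d = quadForm η a b c d + quadForm η a e c d := by
  rw [quadForm_swap_middle hη, quadForm_add_third hη, quadForm_swap_middle hη a c,
    quadForm_swap_middle hη a c]

lemma quadForm_add_first (hη : CompletelySymmetric η) (a b c d e : Fin N → ℝ) :
    quadForm η (a + e) b c d = quadForm η a b c d + quadForm η e b c d := by
  rw [quadForm_swap_first hη, quadForm_add_second hη, quadForm_swap_first hη b,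
    quadForm_swap_first hη b]

lemma quadForm_add_diag (hη : CompletelySymmetric η) (y v : Fin N → ℝ) :
    quadForm η (y + v) (y + v) (y + v) (y + v) = quadForm η y y y y +
      4 * quadForm η y y y v + 6 * quadForm η y y v v + 4 * quadForm η y v v v +
      quadForm η v v v v := by
  simp only [quadForm_add_right, quadForm_add_third hη, quadForm_add_second hη,
    quadForm_add_first hη]
  have swap1 := quadForm_swap_first hη v y
  have swap2 := fun a => quadForm_swap_middle hη a v y
  have swap3 := fun a b => quadForm_swap_last hη a b v y
  simp only [swap1, swap2, swap3]
  ring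

lemma abs_quadForm_le (a b c d : Fin N → ℝ) :
    |quadForm η a b c d| ≤ specNorm η * (√(∑ i, a i ^ 2) * √(∑ i, b i ^ 2) *
      √(∑ i, c i ^ 2) * √(∑ i, d i ^ 2)) := by
  let P : (Fin N → ℝ) → (Fin N → ℝ) → EuclideanSpace ℝ (Fin N × Fin N) :=
    fun u v => WithLp.toLp 2 fun p => u p.1 * v p.2
  have hP (u v : Fin N → ℝ) : ‖P u v‖ = √(∑ i, u i ^ 2) * √(∑ i, v i ^ 2) := by
    rw [← Real.sqrt_mul (Finset.sum_nonneg fun i _ => sq_nonneg _), EuclideanSpace.norm_eq,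
      Fintype.sum_prod_type, Finset.sum_mul_sum]
    simp [P, mul_pow]
  have hT : quadForm η a b c d =
      inner ℝ (P a c) (LinearMap.toContinuousLinearMap (Matrix.toEuclideanLin η) (P b d)) := by
    simp only [quadForm, P, PiLp.inner_apply, LinearMap.coe_toContinuousLinearMap',
      Matrix.toLpLin_apply, Matrix.mulVec, dotProduct, Fintype.sum_prod_type, RCLike.inner_apply,
      conj_trivial, Finset.sum_mul]
    refine Finset.sum_congr rfl fun i _ => ?_
    rw [Finset.sum_comm]
    refine Finset.sum_congr rfl fun k _ => Finset.sum_congr rfl fun j _ =>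
      Finset.sum_congr rfl fun l _ => ?_
    ring
  rw [hT]
  calc _ ≤ ‖P a c‖ * ‖LinearMap.toContinuousLinearMap (Matrix.toEuclideanLin η) (P b d)‖ :=
        abs_real_inner_le_norm _ _
    _ ≤ ‖P a c‖ * (specNorm η * ‖P b d‖) := by
        gcongr
        exact ContinuousLinearMap.le_opNorm _ _
    _ = _ := by rw [hP, hP]; ring

/-- First-order optimality: at a local maximizer `y` on the sphere, the gradient of the quartic
form is normal to the sphere. -/
lemma quadForm_eq_of_isLocalMaxOn (hη : CompletelySymmetric η) {y : Fin N → ℝ}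
    (hy : ∑ i, y i ^ 2 = 1)
    (hmax : IsLocalMaxOn (fquart η) {x : Fin N → ℝ | ∑ i, x i ^ 2 = 1} y) (w : Fin N → ℝ) :
    quadForm η y y y w = quadForm η y y y y * ∑ i, y i * w i := by
  let n : ℝ → ℝ := fun t => ∑ i, (y + t • w) i ^ 2
  have hn (t : ℝ) : n t = 1 + 2 * t * (∑ i, y i * w i) + t ^ 2 * ∑ i, w i ^ 2 := by
    rw [← hy, Finset.mul_sum, Finset.mul_sum, ← Finset.sum_add_distrib,
      ← Finset.sum_add_distrib]
    refine Finset.sum_congr rfl fun i _ => ?_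
    simp only [Pi.add_apply, Pi.smul_apply, smul_eq_mul]
    ring
  have hn0 : n 0 = 1 := by simp [hn]
  have hnc : Continuous n := by fun_prop
  have hpos : ∀ᶠ t in nhds 0, 0 < n t :=
    hnc.continuousAt.eventually (lt_mem_nhds (by rw [hn0]; exact one_pos))
  let g : ℝ → Fin N → ℝ := fun t => (√(n t))⁻¹ • (y + t • w)
  have hg : Filter.Tendsto g (nhds 0) (nhds y) := by
    have : ContinuousAt g 0 :=
      (hnc.sqrt.continuousAt.inv₀ (by simp [hn0])).smul (by fun_prop)
    simpa [ContinuousAt, g, hn0] using this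
  have hgs : ∀ᶠ t in nhds 0, g t ∈ {x : Fin N → ℝ | ∑ i, x i ^ 2 = 1} := by
    filter_upwards [hpos] with t ht
    simp only [g, Pi.smul_apply, smul_eq_mul, mul_pow, ← Finset.mul_sum,
      inv_pow, Real.sq_sqrt ht.le]
    exact inv_mul_cancel₀ ht.ne'
  let h : ℝ → ℝ := fun t => quadForm η y y y y * n t ^ 2 -
    quadForm η (y + t • w) (y + t • w) (y + t • w) (y + t • w)
  have hh (t : ℝ) : h t = quadForm η y y y y *
      (1 + 2 * t * (∑ i, y i * w i) + t ^ 2 * ∑ i, w i ^ 2) ^ 2 -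
      (quadForm η y y y y + 4 * t * quadForm η y y y w + 6 * t ^ 2 * quadForm η y y w w +
        4 * t ^ 3 * quadForm η y w w w + t ^ 4 * quadForm η w w w w) := by
    have e1 := quadForm_smul (η := η) y y y w 1 1 1 t
    have e2 := quadForm_smul (η := η) y y w w 1 1 t t
    have e3 := quadForm_smul (η := η) y w w w 1 t t t
    have e4 := quadForm_smul (η := η) w w w w t t t t
    simp only [one_smul] at e1 e2 e3
    simp only [h, hn, quadForm_add_diag hη, e1, e2, e3, e4]
    ring
  have hmin : IsLocalMin h 0 := by
    filter_upwards [(tendsto_nhdsWithin_iff.2 ⟨hg, hgs⟩).eventually hmax, hpos] with t ht hnt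
    have h0 : h 0 = 0 := by simp [hh]
    rw [fquart_eq_quadForm, fquart_eq_quadForm, quadForm_smul] at ht
    have hs : (√(n t))⁻¹ * (√(n t))⁻¹ * (√(n t))⁻¹ * (√(n t))⁻¹ = (n t ^ 2)⁻¹ := by
      rw [← Real.sq_sqrt hnt.le, Real.sqrt_sq (Real.sqrt_nonneg _)]
      ring
    rw [hs, mul_le_mul_iff_right₀ (by norm_num), inv_mul_le_iff₀ (by positivity)] at ht
    rw [h0]
    simp only [h]
    linarith
  have hd : HasDerivAt h
      (4 * (quadForm η y y y y * ∑ i, y i * w i) - 4 * quadForm η y y y w) 0 := by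
    rw [funext hh]
    have hid := hasDerivAt_id (0 : ℝ)
    have d1 := (((((hid.const_mul 2).mul_const (∑ i, y i * w i)).const_add 1).add
      ((hid.pow 2).mul_const (∑ i, w i ^ 2))).pow 2).const_mul (quadForm η y y y y)
    have d2 := ((((((hid.const_mul 4).mul_const (quadForm η y y y w)).const_add
      (quadForm η y y y y)).add (((hid.pow 2).const_mul 6).mul_const (quadForm η y y w w))).add
      (((hid.pow 3).const_mul 4).mul_const (quadForm η y w w w))).add
      ((hid.pow 4).mul_const (quadForm η w w w w)))
    refine (d1.sub d2).congr_deriv ?_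
    simp
    ring
  linarith [hmin.hasDerivAt_eq_zero hd]

end quadForm

/-- If `x*` is a local maximizer of `f` on the unit sphere, then for every unit vector
`x`, `|f(x*) − f(x)| ≤ 2 ‖η‖₂ ‖x − x*‖²`. -/
theorem local_max_quadratic_bound {N : ℕ}
    (η : Matrix (Fin N × Fin N) (Fin N × Fin N) ℝ) (hη : CompletelySymmetric η)
    (xs : Fin N → ℝ) (hxs : ∑ i, xs i ^ 2 = 1)
    (hmax : IsLocalMaxOn (fquart η) {x : Fin N → ℝ | ∑ i, x i ^ 2 = 1} xs)
    (x : Fin N → ℝ) (hx : ∑ i, x i ^ 2 = 1) :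
    |fquart η xs - fquart η x| ≤
      2 * specNorm η * Real.sqrt (∑ i, (x i - xs i) ^ 2) ^ 2 := by
  obtain ⟨v, rfl⟩ : ∃ v, x = xs + v := ⟨x - xs, by simp⟩
  simp only [Pi.add_apply, add_sub_cancel_left] at hx ⊢
  set q := √(∑ i, v i ^ 2) with hq
  have hq2 : q ^ 2 = ∑ i, v i ^ 2 := Real.sq_sqrt (Finset.sum_nonneg fun i _ => sq_nonneg _)
  have hinner : ∑ i, xs i * v i = -q ^ 2 / 2 := by
    simp only [add_sq, Finset.sum_add_distrib, mul_assoc, ← Finset.mul_sum] at hx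
    linarith
  have hgrad := quadForm_eq_of_isLocalMaxOn hη hxs hmax v
  rw [hinner] at hgrad
  have hx' : √(∑ i, (xs + v) i ^ 2) = 1 := by simp [hx]
  have hxs' : √(∑ i, xs i ^ 2) = 1 := by simp [hxs]
  have b0 := abs_quadForm_le (η := η) xs xs xs xs
  have b1 := abs_quadForm_le (η := η) xs xs v v
  have b2 := abs_quadForm_le (η := η) (xs + v) (xs + v) v v
  have b3 := abs_quadForm_le (η := η) xs (xs + v) v v
  simp only [hx', hxs', ← hq, one_mul, mul_one] at b0 b1 b2 b3
  have hexp : quadForm η (xs + v) (xs + v) (xs + v) (xs + v) = quadForm η xs xs xs xs +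
      4 * quadForm η xs xs xs v + 3 * quadForm η xs xs v v + 2 * quadForm η xs (xs + v) v v +
      quadForm η (xs + v) (xs + v) v v := by
    rw [quadForm_add_diag hη]
    simp only [quadForm_add_first hη, quadForm_add_second hη, quadForm_swap_first hη v xs]
    ring
  rw [fquart_eq_quadForm, fquart_eq_quadForm, hexp, hgrad]
  have b0' : |quadForm η xs xs xs xs * q ^ 2| ≤ specNorm η * q ^ 2 := by
    rw [abs_mul, abs_of_nonneg (sq_nonneg q)]
    gcongr
  rw [abs_le] at b0' b1 b2 b3 ⊢
  constructor <;> linarith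
end
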